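/- arXiv:1905.00385 — 2 statements merged into one kernel-verified Lean document; each statement's English description precedes it below -/
import Mathlib

section
/- Let T ∈ DCS(3,f) be stable relative to the boundary of its carrying simplex, i.e., γᵢⱼ ≠ 0 for all i ≠ j and, for every fixed point v of T having exactly two positive coordinates (say vₖ = 0), Σⱼ μₖⱼ vⱼ ≠ 1. For any fixed point x̂ of T with det(I − DT(x̂)) ≠ 0, define ind(x̂) = sgn det(I − DT(x̂)). Then T has finitely many fixed points, det(I − DT(x̂)) ≠ 0 for every nonzero fixed point x̂, T has at most one fixed point in int ℝ₊³, and Σᵢ₌₁³ ind(q₍ᵢ₎) + 2·Σ_{v planar} ind(v) + 4·Σ_{p positive} ind(p) = 1, where q₍ᵢ₎ = (1/μᵢᵢ)eᵢ are the three axial fixed points, the planar sum runs over the fixed points with exactly two positive coordinates, and the positive sum runs over the fixed points in int ℝ₊³. -/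
open Set Filter Metric Topology Polynomial

/-- The class 𝓕 of C¹ growth functions `f(z,r)` defined on ℝ₊ × (0,∞),
bundled with the partial derivative `fz = ∂f/∂z`, satisfying
(i) f(r,r) = 1 and ∂f/∂z < 0, and (ii) f(z,r) + z ∂f/∂z(z,r) > 0. -/
structure GrowthF where
  f : ℝ → ℝ → ℝ
  fz : ℝ → ℝ → ℝ
  smooth : ContDiffOn ℝ 1 (fun p : ℝ × ℝ => f p.1 p.2) (Set.Ici 0 ×ˢ Set.Ioi 0)
  hasDeriv : ∀ z r : ℝ, 0 ≤ z → 0 < r →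
    HasDerivWithinAt (fun w => f w r) (fz z r) (Set.Ici 0) z
  pos : ∀ z r : ℝ, 0 ≤ z → 0 < r → 0 < f z r
  unit : ∀ r : ℝ, 0 < r → f r r = 1
  fz_neg : ∀ z r : ℝ, 0 ≤ z → 0 < r → fz z r < 0
  contest : ∀ z r : ℝ, 0 ≤ z → 0 < r → 0 < f z r + z * fz z r

/-- The nonnegative cone ℝ₊ⁿ. -/
def orthant (n : ℕ) : Set (Fin n → ℝ) := {x | ∀ i, 0 ≤ x i}

/-- The open cone int ℝ₊ⁿ. -/
def intOrthant (n : ℕ) : Set (Fin n → ℝ) := {x | ∀ i, 0 < x i}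

/-- The boundary ∂ℝ₊ⁿ = ℝ₊ⁿ \ int ℝ₊ⁿ. -/
def bdryOrthant (n : ℕ) : Set (Fin n → ℝ) := orthant n \ intOrthant n

/-- Fᵢ(x) = fᵢ(rᵢ Σⱼ μᵢⱼ xⱼ, rᵢ). -/
def DCS.F {n : ℕ} (fam : Fin n → GrowthF) (r : Fin n → ℝ) (μ : Fin n → Fin n → ℝ)
    (i : Fin n) (x : Fin n → ℝ) : ℝ :=
  (fam i).f (r i * ∑ j, μ i j * x j) (r i)

/-- A map T of the class DCS(n,f): Tᵢ(x) = xᵢ fᵢ(rᵢ Σⱼ μᵢⱼ xⱼ, rᵢ) = xᵢ Fᵢ(x). -/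
def DCS.map {n : ℕ} (fam : Fin n → GrowthF) (r : Fin n → ℝ) (μ : Fin n → Fin n → ℝ)
    (x : Fin n → ℝ) (i : Fin n) : ℝ :=
  x i * DCS.F fam r μ i x

/-- The Jacobian matrix DT(x): (DT(x))ᵢⱼ = δᵢⱼFᵢ(x) + xᵢ ∂fᵢ/∂z((RUx)ᵢ,rᵢ)·rᵢμᵢⱼ. -/
def DCS.jac {n : ℕ} (fam : Fin n → GrowthF) (r : Fin n → ℝ) (μ : Fin n → Fin n → ℝ)
    (x : Fin n → ℝ) : Matrix (Fin n) (Fin n) ℝ :=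
  Matrix.of fun i j => (if i = j then DCS.F fam r μ i x else 0)
    + x i * (fam i).fz (r i * ∑ k, μ i k * x k) (r i) * (r i * μ i j)

/-- T is permanent: there is a compact positively invariant set `K ⊆ int ℝ₊ⁿ`
absorbing every orbit starting in `int ℝ₊ⁿ`. -/
def Permanent {n : ℕ} (T : (Fin n → ℝ) → (Fin n → ℝ)) : Prop :=
  ∃ K : Set (Fin n → ℝ), IsCompact K ∧ K ⊆ intOrthant n ∧ T '' K ⊆ K ∧
    ∀ x ∈ intOrthant n, ∃ m : ℕ, 0 < m ∧ ∀ k ≥ m, T^[k] x ∈ K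

/-- The fixed point index ind(x̂) = sgn det(I − DT(x̂)). -/
noncomputable def DCS.ind {n : ℕ} (fam : Fin n → GrowthF) (r : Fin n → ℝ)
    (μ : Fin n → Fin n → ℝ) (x : Fin n → ℝ) : ℝ :=
  Real.sign ((1 - DCS.jac fam r μ x).det)

/-- The axial point q₍ᵢ₎ = (1/μᵢᵢ) eᵢ. -/
noncomputable def DCS.axial {n : ℕ} (μ : Fin n → Fin n → ℝ) (i : Fin n) :
    Fin n → ℝ :=
  fun l => if l = i then 1 / μ i i else 0

lemma mulz (x : ℝ) {y : ℝ} (h : y = 0) : x * y = 0 := by rw [h, mul_zero]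
lemma sgnc {x : ℝ} (h : x ≠ 0) : ∃ y, 0 < y ∧ (x = y ∨ x = -y) :=
  ⟨|x|, abs_pos.2 h, by rcases abs_choice x with h | h <;> rw [h] <;> simp⟩
lemma sgnd (x : ℝ) : ∃ y, (y = 0 ∧ x = y) ∨ (0 < y ∧ x = y) ∨ (0 < y ∧ x = -y) := by
  rcases lt_trichotomy x 0 with h | h | h
  · exact ⟨-x, Or.inr (Or.inr ⟨by linarith, by ring⟩)⟩
  · exact ⟨x, Or.inl ⟨h, rfl⟩⟩
  · exact ⟨x, Or.inr (Or.inl ⟨h, rfl⟩)⟩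

set_option linter.unusedSimpArgs false in
set_option maxHeartbeats 0 in
lemma key_idx0 (a b c d e f : ℝ) (ha : 0 < a) (kb : b ≠ 0) (kc : c ≠ 0) (kd : d ≠ 0) (ke : e ≠ 0) (kf : f ≠ 0)
  (D0 D1 D2 : ℝ) (h0 : D0 = a * d + b * f - d * f) (h1 : D1 = c * b + d * e - b * e) (h2 : D2 = e * a + f * c - a * c)
  (n0 : 0 < d * f → D0 ≠ 0) (n1 : 0 < b * e → D1 ≠ 0) (n2 : 0 < a * c → D2 ≠ 0) :
  Real.sign (c * e) + Real.sign (a * f) + Real.sign (b * d)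
   + 2 * ((if 0 < d * f then - Real.sign D0 else 0) + (if 0 < b * e then - Real.sign D1 else 0)
     + (if 0 < a * c then - Real.sign D2 else 0))
   + 4 * (if 0 < D0 ∧ 0 < D1 ∧ 0 < D2 then 1 else if D0 < 0 ∧ D1 < 0 ∧ D2 < 0 then -1 else 0) = 1 := by
  have R1 : a * D1 + b * D2 = c * D0 + d * D2 := by subst h0 h1 h2; ring
  have R2 : a * D1 + b * D2 = e * D0 + f * D1 := by subst h0 h1 h2; ring
  obtain ⟨b, hb, rfl | rfl⟩ := sgnc kb <;> obtain ⟨c, hc, rfl | rfl⟩ := sgnc kc <;>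
  obtain ⟨d, hd, rfl | rfl⟩ := sgnc kd <;> obtain ⟨e, he, rfl | rfl⟩ := sgnc ke <;>
  obtain ⟨f, hf, rfl | rfl⟩ := sgnc kf <;>
  simp only [neg_mul, mul_neg, neg_neg, Left.neg_pos_iff, Left.neg_neg_iff, Real.sign_neg, mul_pos, Real.sign_of_pos, Real.sign_of_neg, ha, hb, hc, hd, he, hf, not_lt_of_gt, if_true, if_false, forall_const, false_implies] at n0 n1 n2 ⊢ <;>
  obtain ⟨D0, ⟨x, rfl⟩ | ⟨x, rfl⟩ | ⟨x, rfl⟩⟩ := sgnd D0 <;>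
  (try (exact absurd x n0)) <;>
  obtain ⟨D1, ⟨y, rfl⟩ | ⟨y, rfl⟩ | ⟨y, rfl⟩⟩ := sgnd D1 <;>
  (try (exact absurd y n1)) <;>
  obtain ⟨D2, ⟨z, rfl⟩ | ⟨z, rfl⟩ | ⟨z, rfl⟩⟩ := sgnd D2 <;>
  (try (exact absurd z n2)) <;>
  simp only [Left.neg_pos_iff, Left.neg_neg_iff, Real.sign_neg, Real.sign_of_pos, Real.sign_of_neg, Real.sign_zero, x, y, z, not_lt_of_gt, if_true, if_false, and_self, and_true, true_and, and_false, false_and, lt_irrefl] <;>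
  first | done | (norm_num; done) | (
    exfalso; clear n0 n1 n2
    have m1 := mul_pos hb hf; have m2 := mul_pos ha hd; have m3 := mul_pos hd he
    have m4 := mul_pos hb hc; have m5 := mul_pos hf hc; have m6 := mul_pos he ha
    have q1 := mul_pos hd hf; have q2 := mul_pos hb he; have q3 := mul_pos ha hc
    first | linarith only [m1, m2, m3, m4, m5, m6, q1, q2, q3, h0, h1, h2, x, y, z] | (
    first | have r1 := mul_pos ha y | have r1 := mulz a y
    first | have r2 := mul_pos hb z | have r2 := mulz b z
    first | have r3 := mul_pos hc x | have r3 := mulz c x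
    first | have r4 := mul_pos hd z | have r4 := mulz d z
    first | have r5 := mul_pos he x | have r5 := mulz e x
    first | have r6 := mul_pos hf y | have r6 := mulz f y
    first | linarith only [r1, r2, r3, r4, r5, r6, R1, R2] | (
    rcases le_total a f with i | i <;> rcases le_total b d with j | j <;>
      rcases le_total c e with k | k <;>
    (have w1 := mul_le_mul_of_nonneg_left i hd.le
     have w2 := mul_le_mul_of_nonneg_left i hc.le
     have w3 := mul_le_mul_of_nonneg_left j hf.le
     have w4 := mul_le_mul_of_nonneg_left j he.le
     have w5 := mul_le_mul_of_nonneg_left k hb.le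
     have w6 := mul_le_mul_of_nonneg_left k ha.le
     first | linarith only [m1, m2, m3, m4, m5, m6, q1, q2, q3, h0, h1, h2, x, y, z, w1, w2, w3, w4, w5, w6]))))

lemma key_idx (a b c d e f : ℝ) (ha : a ≠ 0) (hb : b ≠ 0) (hc : c ≠ 0) (hd : d ≠ 0) (he : e ≠ 0) (hf : f ≠ 0)
  (D0 D1 D2 : ℝ) (h0 : D0 = a * d + b * f - d * f) (h1 : D1 = c * b + d * e - b * e) (h2 : D2 = e * a + f * c - a * c)
  (n0 : 0 < d * f → D0 ≠ 0) (n1 : 0 < b * e → D1 ≠ 0) (n2 : 0 < a * c → D2 ≠ 0) :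
  Real.sign (c * e) + Real.sign (a * f) + Real.sign (b * d)
   + 2 * ((if 0 < d * f then - Real.sign D0 else 0) + (if 0 < b * e then - Real.sign D1 else 0)
     + (if 0 < a * c then - Real.sign D2 else 0))
   + 4 * (if 0 < D0 ∧ 0 < D1 ∧ 0 < D2 then 1 else if D0 < 0 ∧ D1 < 0 ∧ D2 < 0 then -1 else 0) = 1 := by
  rcases lt_or_gt_of_ne ha with ha | ha
  · have := key_idx0 (-a) (-b) (-c) (-d) (-e) (-f) (by linarith) (neg_ne_zero.2 hb) (neg_ne_zero.2 hc)
      (neg_ne_zero.2 hd) (neg_ne_zero.2 he) (neg_ne_zero.2 hf) D0 D1 D2 (by rw [h0]; ring) (by rw [h1]; ring)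
      (by rw [h2]; ring)
    simp only [neg_mul_neg] at this
    exact this n0 n1 n2
  · exact key_idx0 a b c d e f ha hb hc hd he hf D0 D1 D2 h0 h1 h2 n0 n1 n2

lemma nonsing0 (a b c d e f p0 p1 p2 : ℝ) (ha : 0 < a) (hb : b ≠ 0) (hd : d ≠ 0) (hf : f ≠ 0)
    (h0 : 0 < p0) (h1 : 0 < p1) (h2 : 0 < p2)
    (e1 : a * p1 + b * p2 = c * p0 + d * p2) (e2 : a * p1 + b * p2 = e * p0 + f * p1)
    (D2 : e * a + f * c - a * c = 0)
    (n0 : d * f ≤ 0) (n1 : b * e ≤ 0) (n2 : a * c ≤ 0) (hc : c ≠ 0) (he : e ≠ 0) : False := by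
  have hc : c < 0 := by
    rcases lt_or_gt_of_ne hc with h | h
    · exact h
    · nlinarith [mul_pos ha h]
  have hf' : 0 < f := by
    rcases lt_or_gt_of_ne hf with hf | hf
    · exfalso
      rcases lt_or_gt_of_ne hb with hb | hb
      · have : 0 < e := by
          rcases lt_or_gt_of_ne he with h | h
          · nlinarith [mul_pos_of_neg_of_neg hb h]
          · exact h
        nlinarith [mul_pos this ha, mul_pos_of_neg_of_neg hf hc]
      · have : e < 0 := by
          rcases lt_or_gt_of_ne he with h | h
          · exact h
          · nlinarith [mul_pos hb h]
        nlinarith [mul_pos ha h1, mul_pos hb h2, mul_neg_of_neg_of_pos this h0, mul_neg_of_neg_of_pos hf h1]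
    · exact hf
  have hd' : d < 0 := by
    rcases lt_or_gt_of_ne hd with h | h
    · exact h
    · nlinarith [mul_pos h hf']
  have z1 := mul_neg_of_neg_of_pos hc h0
  have z2 := mul_neg_of_neg_of_pos hd' h2
  have z3 := mul_pos ha h1
  have z4 := mul_pos hf' h1
  rcases lt_or_gt_of_ne hb with hb | hb
  · have : 0 < e := by
      rcases lt_or_gt_of_ne he with h | h
      · nlinarith [mul_pos_of_neg_of_neg hb h]
      · exact h
    nlinarith [mul_pos this h0]
  · nlinarith [mul_pos hb h2]

lemma nonsing (a b c d e f p0 p1 p2 : ℝ) (ha : a ≠ 0) (hb : b ≠ 0) (hc : c ≠ 0) (hd : d ≠ 0)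
    (he : e ≠ 0) (hf : f ≠ 0)
    (h0 : 0 < p0) (h1 : 0 < p1) (h2 : 0 < p2)
    (e1 : a * p1 + b * p2 = c * p0 + d * p2) (e2 : a * p1 + b * p2 = e * p0 + f * p1)
    (D2 : e * a + f * c - a * c = 0)
    (n0 : d * f ≤ 0) (n1 : b * e ≤ 0) (n2 : a * c ≤ 0) : False := by
  rcases lt_or_gt_of_ne ha with h | h
  · exact nonsing0 (-a) (-b) (-c) (-d) (-e) (-f) p0 p1 p2 (by linarith) (neg_ne_zero.2 hb)
      (neg_ne_zero.2 hd) (neg_ne_zero.2 hf) h0 h1 h2 (by linarith) (by linarith) (by linarith)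
      (by linarith) (by linarith) (by linarith) (neg_ne_zero.2 hc) (neg_ne_zero.2 he)
  · exact nonsing0 a b c d e f p0 p1 p2 h hb hd hf h0 h1 h2 e1 e2 D2 n0 n1 n2 hc he

lemma GrowthF.anti (g : GrowthF) {r : ℝ} (hr : 0 < r) :
    StrictAntiOn (fun z => g.f z r) (Set.Ici 0) := by
  apply strictAntiOn_of_deriv_neg (convex_Ici 0)
  · intro z hz
    exact (g.hasDeriv z r hz hr).continuousWithinAt
  · intro z hz
    rw [interior_Ici] at hz
    have := (g.hasDeriv z r (le_of_lt hz) hr).hasDerivAt (Ici_mem_nhds hz)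
    rw [this.deriv]
    exact g.fz_neg z r (le_of_lt hz) hr

lemma sum_nn {μ : Fin 3 → Fin 3 → ℝ} (hμ : ∀ i j, 0 < μ i j) {x : Fin 3 → ℝ} (hx : x ∈ orthant 3)
    (i : Fin 3) : 0 ≤ ∑ j, μ i j * x j :=
  Finset.sum_nonneg fun j _ => mul_nonneg (hμ i j).le (hx j)

lemma F_sign (fam : Fin 3 → GrowthF) (r : Fin 3 → ℝ) (μ : Fin 3 → Fin 3 → ℝ)
    (hr : ∀ i, 0 < r i) (hμ : ∀ i j, 0 < μ i j) {x : Fin 3 → ℝ} (hx : x ∈ orthant 3) (i : Fin 3) :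
    ∃ w, 0 < w ∧ 1 - DCS.F fam r μ i x = w * (∑ j, μ i j * x j - 1) := by
  have hs := sum_nn hμ hx i
  have hz : 0 ≤ r i * ∑ j, μ i j * x j := mul_nonneg (hr i).le hs
  have A := (fam i).anti (hr i)
  have U := (fam i).unit (r i) (hr i)
  unfold DCS.F
  set s := ∑ j, μ i j * x j with hsd
  rcases lt_trichotomy s 1 with h | h | h
  · have h1 : (fam i).f (r i) (r i) < (fam i).f (r i * s) (r i) :=
      A (a := r i * s) (b := r i) hz (hr i).le (by nlinarith [hr i])
    refine ⟨(1 - (fam i).f (r i * s) (r i)) / (s - 1), div_pos_of_neg_of_neg (by linarith) (by linarith), ?_⟩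
    rw [div_mul_cancel₀ _ (by linarith)]
  · exact ⟨1, one_pos, by rw [h, mul_one, U]; ring⟩
  · have h1 : (fam i).f (r i * s) (r i) < (fam i).f (r i) (r i) :=
      A (a := r i) (b := r i * s) (hr i).le hz (by nlinarith [hr i])
    refine ⟨(1 - (fam i).f (r i * s) (r i)) / (s - 1), div_pos (by linarith) (by linarith), ?_⟩
    rw [div_mul_cancel₀ _ (by linarith)]

lemma fixed_iff (fam : Fin 3 → GrowthF) (r : Fin 3 → ℝ) (μ : Fin 3 → Fin 3 → ℝ)
    (hr : ∀ i, 0 < r i) (hμ : ∀ i j, 0 < μ i j) {x : Fin 3 → ℝ} (hx : x ∈ orthant 3) :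
    DCS.map fam r μ x = x ↔ ∀ i, x i = 0 ∨ ∑ j, μ i j * x j = 1 := by
  rw [funext_iff]
  refine forall_congr' fun i => ?_
  obtain ⟨w, hw, h⟩ := F_sign fam r μ hr hμ hx i
  unfold DCS.map
  have : x i * DCS.F fam r μ i x = x i - x i * (w * (∑ j, μ i j * x j - 1)) := by
    rw [← h]; ring
  rw [this]
  constructor
  · intro k
    have : x i * (w * (∑ j, μ i j * x j - 1)) = 0 := by linarith
    rcases mul_eq_zero.1 this with h | h
    · exact Or.inl h
    · right
      rcases mul_eq_zero.1 h with h | h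
      · exact absurd h hw.ne'
      · linarith
  · rintro (k | k)
    · simp [k]
    · simp [k]

/-- reduced matrix -/
noncomputable def redM (μ : Fin 3 → Fin 3 → ℝ) (x : Fin 3 → ℝ) : Matrix (Fin 3) (Fin 3) ℝ :=
  Matrix.of fun i j => open Classical in if x i = 0 then (if i = j then ∑ k, μ i k * x k - 1 else 0) else μ i j

lemma det_red (fam : Fin 3 → GrowthF) (r : Fin 3 → ℝ) (μ : Fin 3 → Fin 3 → ℝ)
    (hr : ∀ i, 0 < r i) (hμ : ∀ i j, 0 < μ i j) {x : Fin 3 → ℝ} (hx : x ∈ orthant 3)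
    (hfix : DCS.map fam r μ x = x) :
    ∃ w, 0 < w ∧ (1 - DCS.jac fam r μ x).det = w * (redM μ x).det := by
  have key : ∀ i, ∃ w, 0 < w ∧ ∀ j, (1 - DCS.jac fam r μ x) i j = w * redM μ x i j := by
    intro i
    obtain ⟨w, hw, h⟩ := F_sign fam r μ hr hμ hx i
    by_cases hi : x i = 0
    · refine ⟨w, hw, fun j => ?_⟩
      simp only [DCS.jac, redM, Matrix.sub_apply, Matrix.of_apply, hi, Matrix.one_apply, if_true]
      split_ifs with hij
      · rw [← h]; ring
      · ring
    · have hs := ((fixed_iff fam r μ hr hμ hx).1 hfix i).resolve_left hi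
      have hF : DCS.F fam r μ i x = 1 := by rw [hs] at h; linarith
      have hxi : 0 < x i := lt_of_le_of_ne (hx i) (Ne.symm hi)
      have hneg := (fam i).fz_neg (r i * ∑ k, μ i k * x k) (r i)
        (mul_nonneg (hr i).le (sum_nn hμ hx i)) (hr i)
      refine ⟨x i * (-(fam i).fz (r i * ∑ k, μ i k * x k) (r i)) * r i,
        mul_pos (mul_pos hxi (by linarith)) (hr i), fun j => ?_⟩
      simp only [DCS.jac, redM, Matrix.sub_apply, Matrix.of_apply, hi, Matrix.one_apply, if_false, hF]
      split_ifs <;> ring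
  choose w hw h using key
  refine ⟨∏ i, w i, Finset.prod_pos fun i _ => hw i, ?_⟩
  rw [← Matrix.det_mul_column]
  congr 1
  ext i j
  exact h i j

lemma sign_pos_mul {w : ℝ} (hw : 0 < w) (x : ℝ) : Real.sign (w * x) = Real.sign x := by
  rcases lt_trichotomy x 0 with h | h | h
  · rw [Real.sign_of_neg h, Real.sign_of_neg (mul_neg_of_pos_of_neg hw h)]
  · simp [h]
  · rw [Real.sign_of_pos h, Real.sign_of_pos (mul_pos hw h)]

lemma ind_red (fam : Fin 3 → GrowthF) (r : Fin 3 → ℝ) (μ : Fin 3 → Fin 3 → ℝ)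
    (hr : ∀ i, 0 < r i) (hμ : ∀ i j, 0 < μ i j) {x : Fin 3 → ℝ} (hx : x ∈ orthant 3)
    (hfix : DCS.map fam r μ x = x) :
    DCS.ind fam r μ x = Real.sign (redM μ x).det := by
  obtain ⟨w, hw, h⟩ := det_red fam r μ hr hμ hx hfix
  rw [DCS.ind, h, sign_pos_mul hw]

lemma sum3 {i j k : Fin 3} (hij : i ≠ j) (hik : i ≠ k) (hjk : j ≠ k) (g : Fin 3 → ℝ) :
    ∑ l, g l = g i + g j + g k := by
  have : (Finset.univ : Finset (Fin 3)) = {i, j, k} := by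
    revert i j k; decide
  rw [this, Finset.sum_insert (by simp [hij, hik]), Finset.sum_insert (by simp [hjk]),
    Finset.sum_singleton]
  ring

lemma all3 {i j k : Fin 3} (hij : i ≠ j) (hik : i ≠ k) (hjk : j ≠ k) (l : Fin 3) :
    l = i ∨ l = j ∨ l = k := by
  revert i j k l; decide

/-- `det` of `μ` with column `k` replaced by ones. -/
def DD (μ : Fin 3 → Fin 3 → ℝ) (i j k : Fin 3) : ℝ :=
  (μ i i - μ k i) * (μ j j - μ i j) + (μ j j - μ k j) * (μ i i - μ j i)
    - (μ j j - μ i j) * (μ i i - μ j i)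

/-- planar fixed points with `v k = 0` -/
def PS (fam : Fin 3 → GrowthF) (r : Fin 3 → ℝ) (μ : Fin 3 → Fin 3 → ℝ) (k : Fin 3) :
    Set (Fin 3 → ℝ) :=
  {v | v ∈ orthant 3 ∧ DCS.map fam r μ v = v ∧ v k = 0 ∧ ∀ j, j ≠ k → 0 < v j}

lemma redM_planar (μ : Fin 3 → Fin 3 → ℝ) {x : Fin 3 → ℝ} {i j k : Fin 3} (hij : i ≠ j) (hik : i ≠ k)
    (hjk : j ≠ k) (hi : x i ≠ 0) (hj : x j ≠ 0) (hk : x k = 0) :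
    (redM μ x).det = (μ i i * μ j j - μ i j * μ j i) * (∑ l, μ k l * x l - 1) := by
  rw [Matrix.det_fin_three]
  simp only [redM, Matrix.of_apply]
  fin_cases i <;> fin_cases j <;> fin_cases k <;>
    simp at hij hik hjk hi hj hk <;> simp [hi, hj, hk, -mul_eq_mul_left_iff, -mul_eq_mul_right_iff] <;> ring

lemma redM_axial (μ : Fin 3 → Fin 3 → ℝ) {x : Fin 3 → ℝ} {i j k : Fin 3} (hij : i ≠ j) (hik : i ≠ k)
    (hjk : j ≠ k) (hi : x i ≠ 0) (hj : x j = 0) (hk : x k = 0) :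
    (redM μ x).det = μ i i * (∑ l, μ j l * x l - 1) * (∑ l, μ k l * x l - 1) := by
  rw [Matrix.det_fin_three]
  simp only [redM, Matrix.of_apply]
  fin_cases i <;> fin_cases j <;> fin_cases k <;>
    simp at hij hik hjk hi hj hk <;> simp [hi, hj, hk, -mul_eq_mul_left_iff, -mul_eq_mul_right_iff] <;> ring

lemma PS_eqs (fam : Fin 3 → GrowthF) (r : Fin 3 → ℝ) (μ : Fin 3 → Fin 3 → ℝ)
    (hr : ∀ i, 0 < r i) (hμ : ∀ i j, 0 < μ i j)
    {i j k : Fin 3} (hij : i ≠ j) (hik : i ≠ k) (hjk : j ≠ k) {v : Fin 3 → ℝ} (hv : v ∈ PS fam r μ k) :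
    μ i i * v i + μ i j * v j = 1 ∧ μ j i * v i + μ j j * v j = 1 ∧
    ∑ l, μ k l * v l = μ k i * v i + μ k j * v j ∧ v k = 0 ∧ 0 < v i ∧ 0 < v j := by
  obtain ⟨ho, hf, h0, hp⟩ := hv
  have hi := hp i hik
  have hj := hp j hjk
  have H := (fixed_iff fam r μ hr hμ ho).1 hf
  have Hi := (H i).resolve_left hi.ne'
  have Hj := (H j).resolve_left hj.ne'
  rw [sum3 hij hik hjk, h0] at Hi Hj
  rw [sum3 hij hik hjk, h0]
  exact ⟨by linarith, by linarith, by ring, rfl, hi, hj⟩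

lemma PS_props (fam : Fin 3 → GrowthF) (r : Fin 3 → ℝ) (μ : Fin 3 → Fin 3 → ℝ)
    (hr : ∀ i, 0 < r i) (hμ : ∀ i j, 0 < μ i j)
    (hγ : ∀ i j, i ≠ j → μ i i - μ j i ≠ 0)
    (hplanar : ∀ v ∈ orthant 3, DCS.map fam r μ v = v →
      ∀ k : Fin 3, v k = 0 → (∀ j, j ≠ k → 0 < v j) →
        (∑ j, μ k j * v j) ≠ 1)
    {i j k : Fin 3} (hij : i ≠ j) (hik : i ≠ k) (hjk : j ≠ k) {v : Fin 3 → ℝ} (hv : v ∈ PS fam r μ k) :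
    μ i i * μ j j - μ i j * μ j i ≠ 0 ∧
    (μ i i * μ j j - μ i j * μ j i) * v i = μ j j - μ i j ∧
    (μ i i * μ j j - μ i j * μ j i) * v j = μ i i - μ j i ∧
    0 < (μ j j - μ i j) * (μ i i - μ j i) ∧ DD μ i j k ≠ 0 ∧ (redM μ v).det = - DD μ i j k := by
  obtain ⟨h1, h2, h3, h4, h5, h6⟩ := PS_eqs fam r μ hr hμ hij hik hjk hv
  have a1 : (μ i i * μ j j - μ i j * μ j i) * v i = μ j j - μ i j := by
    linear_combination μ j j * h1 - μ i j * h2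
  have a2 : (μ i i * μ j j - μ i j * μ j i) * v j = μ i i - μ j i := by
    linear_combination μ i i * h2 - μ j i * h1
  have a0 : μ i i * μ j j - μ i j * μ j i ≠ 0 := by
    intro h
    rw [h, zero_mul] at a2
    exact hγ i j hij a2.symm
  have a3 : (redM μ v).det = - DD μ i j k := by
    rw [redM_planar μ hij hik hjk h5.ne' h6.ne' h4, h3, DD]
    linear_combination μ k i * a1 + μ k j * a2
  refine ⟨a0, a1, a2, ?_, ?_, a3⟩
  · rw [← a1, ← a2]
    have := mul_pos (mul_self_pos.2 a0) (mul_pos h5 h6)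
    linarith
  · intro h
    rw [h, neg_zero, redM_planar μ hij hik hjk h5.ne' h6.ne' h4] at a3
    rcases mul_eq_zero.1 a3 with h | h
    · exact a0 h
    · exact hplanar v hv.1 hv.2.1 k h4 hv.2.2.2 (by linarith)

lemma PS_exists (fam : Fin 3 → GrowthF) (r : Fin 3 → ℝ) (μ : Fin 3 → Fin 3 → ℝ)
    (hr : ∀ i, 0 < r i) (hμ : ∀ i j, 0 < μ i j)
    {i j k : Fin 3} (hij : i ≠ j) (hik : i ≠ k) (hjk : j ≠ k)
    (h : 0 < (μ j j - μ i j) * (μ i i - μ j i)) : (PS fam r μ k).Nonempty := by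
  have p1 := hμ i i
  have p2 := hμ i j
  have p3 := hμ j i
  have p4 := hμ j j
  set Δ := μ i i * μ j j - μ i j * μ j i with hΔ
  have q : Δ ≠ 0 ∧ 0 < (μ j j - μ i j) / Δ ∧ 0 < (μ i i - μ j i) / Δ := by
    rcases pos_and_pos_or_neg_and_neg_of_mul_pos h with ⟨a, b⟩ | ⟨a, b⟩
    · have : 0 < Δ := by nlinarith [mul_pos a p1, mul_pos b p2]
      exact ⟨this.ne', div_pos a this, div_pos b this⟩
    · have : Δ < 0 := by nlinarith [mul_neg_of_neg_of_pos a p1, mul_neg_of_neg_of_pos b p2]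
      exact ⟨this.ne, div_pos_of_neg_of_neg a this, div_pos_of_neg_of_neg b this⟩
  obtain ⟨q0, q1, q2⟩ := q
  let v : Fin 3 → ℝ := fun l => if l = i then (μ j j - μ i j) / Δ else if l = j then (μ i i - μ j i) / Δ else 0
  have vi : v i = (μ j j - μ i j) / Δ := by simp [v]
  have vj : v j = (μ i i - μ j i) / Δ := by simp [v, hij.symm]
  have vk : v k = 0 := by simp [v, hik.symm, hjk.symm]
  have ho : v ∈ orthant 3 := by
    intro l
    rcases all3 hij hik hjk l with rfl | rfl | rfl
    · rw [vi]; exact q1.le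
    · rw [vj]; exact q2.le
    · rw [vk]
  refine ⟨v, ho, ?_, vk, ?_⟩
  · rw [fixed_iff fam r μ hr hμ ho]
    intro l
    rcases all3 hij hik hjk l with rfl | rfl | rfl
    · right
      rw [sum3 hij hik hjk, vi, vj, vk]
      field_simp
      rw [hΔ]; ring
    · right
      rw [sum3 hij hik hjk, vi, vj, vk]
      field_simp
      rw [hΔ]; ring
    · exact Or.inl vk
  · intro l hl
    rcases all3 hij hik hjk l with rfl | rfl | rfl
    · rw [vi]; exact q1
    · rw [vj]; exact q2
    · exact absurd rfl hl

lemma PS_sub (fam : Fin 3 → GrowthF) (r : Fin 3 → ℝ) (μ : Fin 3 → Fin 3 → ℝ)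
    (hr : ∀ i, 0 < r i) (hμ : ∀ i j, 0 < μ i j)
    (hγ : ∀ i j, i ≠ j → μ i i - μ j i ≠ 0)
    (hplanar : ∀ v ∈ orthant 3, DCS.map fam r μ v = v →
      ∀ k : Fin 3, v k = 0 → (∀ j, j ≠ k → 0 < v j) →
        (∑ j, μ k j * v j) ≠ 1)
    {i j k : Fin 3} (hij : i ≠ j) (hik : i ≠ k) (hjk : j ≠ k) : (PS fam r μ k).Subsingleton := by
  intro v hv w hw
  obtain ⟨h, v1, v2, -⟩ := PS_props fam r μ hr hμ hγ hplanar hij hik hjk hv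
  obtain ⟨-, w1, w2, -⟩ := PS_props fam r μ hr hμ hγ hplanar hij hik hjk hw
  ext l
  rcases all3 hij hik hjk l with rfl | rfl | rfl
  · exact mul_left_cancel₀ h (v1.trans w1.symm)
  · exact mul_left_cancel₀ h (v2.trans w2.symm)
  · exact hv.2.2.1.trans hw.2.2.1.symm

lemma PS_sum (fam : Fin 3 → GrowthF) (r : Fin 3 → ℝ) (μ : Fin 3 → Fin 3 → ℝ)
    (hr : ∀ i, 0 < r i) (hμ : ∀ i j, 0 < μ i j)
    (hγ : ∀ i j, i ≠ j → μ i i - μ j i ≠ 0)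
    (hplanar : ∀ v ∈ orthant 3, DCS.map fam r μ v = v →
      ∀ k : Fin 3, v k = 0 → (∀ j, j ≠ k → 0 < v j) →
        (∑ j, μ k j * v j) ≠ 1)
    {i j k : Fin 3} (hij : i ≠ j) (hik : i ≠ k) (hjk : j ≠ k) :
    (∑ᶠ v ∈ PS fam r μ k, DCS.ind fam r μ v) =
      (if 0 < (μ j j - μ i j) * (μ i i - μ j i) then - Real.sign (DD μ i j k) else 0) ∧
    (0 < (μ j j - μ i j) * (μ i i - μ j i) → DD μ i j k ≠ 0) := by
  rcases (PS_sub fam r μ hr hμ hγ hplanar hij hik hjk).eq_empty_or_singleton with h | ⟨v, h⟩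
  · have : ¬ 0 < (μ j j - μ i j) * (μ i i - μ j i) := by
      intro h'
      have := PS_exists fam r μ hr hμ hij hik hjk h'
      rw [h] at this
      exact Set.not_nonempty_empty this
    rw [if_neg this, h]
    exact ⟨finsum_mem_empty, fun h' => absurd h' this⟩
  · have hv : v ∈ PS fam r μ k := by rw [h]; rfl
    obtain ⟨-, -, -, h1, h2, h3⟩ := PS_props fam r μ hr hμ hγ hplanar hij hik hjk hv
    rw [if_pos h1, h, finsum_mem_singleton, ind_red fam r μ hr hμ hv.1 hv.2.1, h3, Real.sign_neg]
    exact ⟨rfl, fun _ => h2⟩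

lemma axial_ind (fam : Fin 3 → GrowthF) (r : Fin 3 → ℝ) (μ : Fin 3 → Fin 3 → ℝ)
    (hr : ∀ i, 0 < r i) (hμ : ∀ i j, 0 < μ i j)
    {i j k : Fin 3} (hij : i ≠ j) (hik : i ≠ k) (hjk : j ≠ k) :
    DCS.ind fam r μ (DCS.axial μ i) = Real.sign ((μ i i - μ j i) * (μ i i - μ k i)) := by
  have p := hμ i i
  have vi : DCS.axial μ i i = 1 / μ i i := by simp [DCS.axial]
  have vj : DCS.axial μ i j = 0 := by simp [DCS.axial, hij.symm]
  have vk : DCS.axial μ i k = 0 := by simp [DCS.axial, hik.symm]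
  have ho : DCS.axial μ i ∈ orthant 3 := by
    intro l
    rcases all3 hij hik hjk l with rfl | rfl | rfl
    · rw [vi]; positivity
    · rw [vj]
    · rw [vk]
  have hf : DCS.map fam r μ (DCS.axial μ i) = DCS.axial μ i := by
    rw [fixed_iff fam r μ hr hμ ho]
    intro l
    rcases all3 hij hik hjk l with rfl | rfl | rfl
    · right
      rw [sum3 hij hik hjk, vi, vj, vk]
      field_simp
      ring
    · exact Or.inl vj
    · exact Or.inl vk
  rw [ind_red fam r μ hr hμ ho hf, redM_axial μ hij hik hjk (by rw [vi]; positivity) vj vk,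
    sum3 hij hik hjk, sum3 hij hik hjk, vi, vj, vk, ← sign_pos_mul (one_div_pos.2 p) ((μ i i - μ j i) * (μ i i - μ k i))]
  congr 1
  field_simp
  ring

/-- positive fixed points -/
def QS (fam : Fin 3 → GrowthF) (r : Fin 3 → ℝ) (μ : Fin 3 → Fin 3 → ℝ) : Set (Fin 3 → ℝ) :=
  {p ∈ intOrthant 3 | DCS.map fam r μ p = p}

lemma QS_props (fam : Fin 3 → GrowthF) (r : Fin 3 → ℝ) (μ : Fin 3 → Fin 3 → ℝ)
    (hr : ∀ i, 0 < r i) (hμ : ∀ i j, 0 < μ i j)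
    (hγ : ∀ i j, i ≠ j → μ i i - μ j i ≠ 0)
    (hplanar : ∀ v ∈ orthant 3, DCS.map fam r μ v = v →
      ∀ k : Fin 3, v k = 0 → (∀ j, j ≠ k → 0 < v j) →
        (∑ j, μ k j * v j) ≠ 1) {p : Fin 3 → ℝ} (hp : p ∈ QS fam r μ) :
    (redM μ p).det ≠ 0 ∧ (redM μ p).det = (Matrix.of μ).det ∧
    (Matrix.of μ).det * p 0 = DD μ 1 2 0 ∧ (Matrix.of μ).det * p 1 = DD μ 0 2 1 ∧
    (Matrix.of μ).det * p 2 = DD μ 0 1 2 := by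
  obtain ⟨hp, hf⟩ := hp
  have ho : p ∈ orthant 3 := fun i => (hp i).le
  have H := (fixed_iff fam r μ hr hμ ho).1 hf
  have p0 := hp 0
  have p1 := hp 1
  have p2 := hp 2
  have e0 := (H 0).resolve_left p0.ne'
  have e1 := (H 1).resolve_left p1.ne'
  have e2 := (H 2).resolve_left p2.ne'
  rw [Fin.sum_univ_three] at e0 e1 e2
  have hd : (redM μ p).det = (Matrix.of μ).det := by
    congr 1
    ext i j
    simp [redM, (hp i).ne']
  have d0 : (Matrix.of μ).det * p 0 = DD μ 1 2 0 := by
    rw [Matrix.det_fin_three, DD]; simp only [Matrix.of_apply]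
    linear_combination (μ 1 1 * μ 2 2 - μ 1 2 * μ 2 1) * e0 + (μ 0 2 * μ 2 1 - μ 0 1 * μ 2 2) * e1
      + (μ 0 1 * μ 1 2 - μ 0 2 * μ 1 1) * e2
  have d1 : (Matrix.of μ).det * p 1 = DD μ 0 2 1 := by
    rw [Matrix.det_fin_three, DD]; simp only [Matrix.of_apply]
    linear_combination (μ 1 2 * μ 2 0 - μ 1 0 * μ 2 2) * e0 + (μ 0 0 * μ 2 2 - μ 0 2 * μ 2 0) * e1
      + (μ 0 2 * μ 1 0 - μ 0 0 * μ 1 2) * e2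
  have d2 : (Matrix.of μ).det * p 2 = DD μ 0 1 2 := by
    rw [Matrix.det_fin_three, DD]; simp only [Matrix.of_apply]
    linear_combination (μ 1 0 * μ 2 1 - μ 1 1 * μ 2 0) * e0 + (μ 0 1 * μ 2 0 - μ 0 0 * μ 2 1) * e1
      + (μ 0 0 * μ 1 1 - μ 0 1 * μ 1 0) * e2
  refine ⟨?_, hd, d0, d1, d2⟩
  rw [hd]
  intro h0
  rw [h0, zero_mul] at d0 d1 d2
  have n0 := (PS_sum fam r μ hr hμ hγ hplanar (i := 1) (j := 2) (k := 0) (by decide) (by decide) (by decide)).2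
  have n1 := (PS_sum fam r μ hr hμ hγ hplanar (i := 0) (j := 2) (k := 1) (by decide) (by decide) (by decide)).2
  have n2 := (PS_sum fam r μ hr hμ hγ hplanar (i := 0) (j := 1) (k := 2) (by decide) (by decide) (by decide)).2
  refine nonsing (μ 1 1 - μ 0 1) (μ 2 2 - μ 0 2) (μ 0 0 - μ 1 0) (μ 2 2 - μ 1 2) (μ 0 0 - μ 2 0)
    (μ 1 1 - μ 2 1) (p 0) (p 1) (p 2) (hγ 1 0 (by decide)) (hγ 2 0 (by decide)) (hγ 0 1 (by decide))
    (hγ 2 1 (by decide)) (hγ 0 2 (by decide)) (hγ 1 2 (by decide)) p0 p1 p2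
    (by linarith) (by linarith) ?_ ?_ ?_ ?_
  · rw [DD] at d2; linarith
  · by_contra! h; exact n0 h d0.symm
  · by_contra! h; exact n1 h d1.symm
  · by_contra! h; exact n2 h d2.symm

lemma QS_sub (fam : Fin 3 → GrowthF) (r : Fin 3 → ℝ) (μ : Fin 3 → Fin 3 → ℝ)
    (hr : ∀ i, 0 < r i) (hμ : ∀ i j, 0 < μ i j)
    (hγ : ∀ i j, i ≠ j → μ i i - μ j i ≠ 0)
    (hplanar : ∀ v ∈ orthant 3, DCS.map fam r μ v = v →
      ∀ k : Fin 3, v k = 0 → (∀ j, j ≠ k → 0 < v j) →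
        (∑ j, μ k j * v j) ≠ 1) : (QS fam r μ).Subsingleton := by
  intro p hp q hq
  obtain ⟨h, h', a0, a1, a2⟩ := QS_props fam r μ hr hμ hγ hplanar hp
  obtain ⟨-, -, b0, b1, b2⟩ := QS_props fam r μ hr hμ hγ hplanar hq
  rw [h'] at h
  ext l
  rcases all3 (i := 0) (j := 1) (k := 2) (by decide) (by decide) (by decide) l with rfl | rfl | rfl
  · exact mul_left_cancel₀ h (a0.trans b0.symm)
  · exact mul_left_cancel₀ h (a1.trans b1.symm)
  · exact mul_left_cancel₀ h (a2.trans b2.symm)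

lemma QS_exists (fam : Fin 3 → GrowthF) (r : Fin 3 → ℝ) (μ : Fin 3 → Fin 3 → ℝ)
    (hr : ∀ i, 0 < r i) (hμ : ∀ i j, 0 < μ i j)
    (h : (0 < DD μ 1 2 0 ∧ 0 < DD μ 0 2 1 ∧ 0 < DD μ 0 1 2) ∨
      (DD μ 1 2 0 < 0 ∧ DD μ 0 2 1 < 0 ∧ DD μ 0 1 2 < 0)) : (QS fam r μ).Nonempty := by
  set M := (Matrix.of μ).det with hM
  have s : ∀ i, μ i 0 * DD μ 1 2 0 + μ i 1 * DD μ 0 2 1 + μ i 2 * DD μ 0 1 2 = M := by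
    intro i
    rw [hM, Matrix.det_fin_three]
    simp only [DD, Matrix.of_apply]
    fin_cases i <;> simp <;> ring
  have m0 := hμ 0 0
  have m1 := hμ 0 1
  have m2 := hμ 0 2
  have q : M ≠ 0 ∧ 0 < DD μ 1 2 0 / M ∧ 0 < DD μ 0 2 1 / M ∧ 0 < DD μ 0 1 2 / M := by
    rcases h with ⟨a, b, c⟩ | ⟨a, b, c⟩
    · have : 0 < M := by rw [← s 0]; positivity
      exact ⟨this.ne', div_pos a this, div_pos b this, div_pos c this⟩
    · have : M < 0 := by
        rw [← s 0]
        linarith [mul_neg_of_pos_of_neg m0 a, mul_neg_of_pos_of_neg m1 b, mul_neg_of_pos_of_neg m2 c]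
      exact ⟨this.ne, div_pos_of_neg_of_neg a this, div_pos_of_neg_of_neg b this,
        div_pos_of_neg_of_neg c this⟩
  obtain ⟨q, q0, q1, q2⟩ := q
  have hp : (![DD μ 1 2 0 / M, DD μ 0 2 1 / M, DD μ 0 1 2 / M] : Fin 3 → ℝ) ∈ intOrthant 3 := by
    intro l
    fin_cases l
    · exact q0
    · exact q1
    · exact q2
  refine ⟨_, hp, ?_⟩
  rw [fixed_iff fam r μ hr hμ (fun i => (hp i).le)]
  intro l
  right
  rw [Fin.sum_univ_three]
  simp only [Matrix.cons_val_zero, Matrix.cons_val_one, Matrix.cons_val]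
  field_simp
  exact s l

lemma QS_sum (fam : Fin 3 → GrowthF) (r : Fin 3 → ℝ) (μ : Fin 3 → Fin 3 → ℝ)
    (hr : ∀ i, 0 < r i) (hμ : ∀ i j, 0 < μ i j)
    (hγ : ∀ i j, i ≠ j → μ i i - μ j i ≠ 0)
    (hplanar : ∀ v ∈ orthant 3, DCS.map fam r μ v = v →
      ∀ k : Fin 3, v k = 0 → (∀ j, j ≠ k → 0 < v j) →
        (∑ j, μ k j * v j) ≠ 1) :
    (∑ᶠ p ∈ QS fam r μ, DCS.ind fam r μ p) =
      if 0 < DD μ 1 2 0 ∧ 0 < DD μ 0 2 1 ∧ 0 < DD μ 0 1 2 then 1 else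
      if DD μ 1 2 0 < 0 ∧ DD μ 0 2 1 < 0 ∧ DD μ 0 1 2 < 0 then -1 else 0 := by
  rcases (QS_sub fam r μ hr hμ hγ hplanar).eq_empty_or_singleton with h | ⟨v, h⟩
  · have := QS_exists fam r μ hr hμ
    rw [h] at this
    have h' := mt this Set.not_nonempty_empty
    push Not at h'
    rw [h, finsum_mem_empty, if_neg (fun k => absurd k.2.2 (not_lt.2 (h'.1 k.1 k.2.1))),
      if_neg (fun k => absurd k.2.2 (not_lt.2 (h'.2 k.1 k.2.1)))]
  · have hv : v ∈ QS fam r μ := by rw [h]; rfl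
    obtain ⟨h1, h2, d0, d1, d2⟩ := QS_props fam r μ hr hμ hγ hplanar hv
    rw [h, finsum_mem_singleton, ind_red fam r μ hr hμ (fun i => (hv.1 i).le) hv.2, ← d0, ← d1, ← d2, h2]
    rw [h2] at h1
    have p0 := hv.1 0
    have p1 := hv.1 1
    have p2 := hv.1 2
    rcases lt_or_gt_of_ne h1 with h1 | h1
    · rw [if_neg (fun k => absurd k.1 (not_lt.2 (mul_neg_of_neg_of_pos h1 p0).le)),
        if_pos ⟨mul_neg_of_neg_of_pos h1 p0, mul_neg_of_neg_of_pos h1 p1, mul_neg_of_neg_of_pos h1 p2⟩,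
        Real.sign_of_neg h1]
    · rw [if_pos ⟨mul_pos h1 p0, mul_pos h1 p1, mul_pos h1 p2⟩, Real.sign_of_pos h1]

/-- classification of fixed points -/
lemma classify (fam : Fin 3 → GrowthF) (r : Fin 3 → ℝ) (μ : Fin 3 → Fin 3 → ℝ)
    (hr : ∀ i, 0 < r i) (hμ : ∀ i j, 0 < μ i j) {x : Fin 3 → ℝ} (hx : x ∈ orthant 3)
    (hf : DCS.map fam r μ x = x) :
    x = 0 ∨ (∃ i, x = DCS.axial μ i) ∨ (∃ k, x ∈ PS fam r μ k) ∨ x ∈ QS fam r μ := by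
  have H := (fixed_iff fam r μ hr hμ hx).1 hf
  have pl : ∀ i j k : Fin 3, i ≠ j → i ≠ k → j ≠ k → x i ≠ 0 → x j ≠ 0 → x k = 0 → x ∈ PS fam r μ k := by
    intro i j k hij hik hjk hi hj hk
    refine ⟨hx, hf, hk, fun l hl => lt_of_le_of_ne (hx l) ?_⟩
    rcases all3 hij hik hjk l with rfl | rfl | rfl
    · exact hi.symm
    · exact hj.symm
    · exact absurd rfl hl
  have ax : ∀ i j k : Fin 3, i ≠ j → i ≠ k → j ≠ k → x i ≠ 0 → x j = 0 → x k = 0 → x = DCS.axial μ i := by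
    intro i j k hij hik hjk hi hj hk
    have Hi := (H i).resolve_left hi
    rw [sum3 hij hik hjk, hj, hk] at Hi
    have p := hμ i i
    ext l
    rcases all3 hij hik hjk l with rfl | rfl | rfl
    · simp only [DCS.axial, if_true]
      field_simp
      linarith
    · simp [DCS.axial, hij.symm, hj]
    · simp [DCS.axial, hik.symm, hk]
  by_cases h0 : x 0 = 0 <;> by_cases h1 : x 1 = 0 <;> by_cases h2 : x 2 = 0
  · left; ext l; fin_cases l <;> assumption
  · exact Or.inr (Or.inl ⟨2, ax 2 0 1 (by decide) (by decide) (by decide) h2 h0 h1⟩)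
  · exact Or.inr (Or.inl ⟨1, ax 1 0 2 (by decide) (by decide) (by decide) h1 h0 h2⟩)
  · exact Or.inr (Or.inr (Or.inl ⟨0, pl 1 2 0 (by decide) (by decide) (by decide) h1 h2 h0⟩))
  · exact Or.inr (Or.inl ⟨0, ax 0 1 2 (by decide) (by decide) (by decide) h0 h1 h2⟩)
  · exact Or.inr (Or.inr (Or.inl ⟨1, pl 0 2 1 (by decide) (by decide) (by decide) h0 h2 h1⟩))
  · exact Or.inr (Or.inr (Or.inl ⟨2, pl 0 1 2 (by decide) (by decide) (by decide) h0 h1 h2⟩))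
  · refine Or.inr (Or.inr (Or.inr ⟨fun l => lt_of_le_of_ne (hx l) ?_, hf⟩))
    fin_cases l
    · exact Ne.symm h0
    · exact Ne.symm h1
    · exact Ne.symm h2

/-- Index formula on the carrying simplex: for T ∈ DCS(3,f)
stable relative to ∂Σ, T has finitely many fixed points, I − DT(x̂) is
nonsingular at each nonzero fixed point, T has at most one positive fixed
point, and Σᵢ ind(q₍ᵢ₎) + 2 Σ_planar ind(v) + 4 Σ_positive ind(p) = 1. -/
theorem stmt16 (fam : Fin 3 → GrowthF) (r : Fin 3 → ℝ) (μ : Fin 3 → Fin 3 → ℝ)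
    (hr : ∀ i, 0 < r i) (hμ : ∀ i j, 0 < μ i j)
    (hγ : ∀ i j, i ≠ j → μ i i - μ j i ≠ 0)
    (hplanar : ∀ v ∈ orthant 3, DCS.map fam r μ v = v →
      ∀ k : Fin 3, v k = 0 → (∀ j, j ≠ k → 0 < v j) →
        (∑ j, μ k j * v j) ≠ 1) :
    Set.Finite {x ∈ orthant 3 | DCS.map fam r μ x = x} ∧
    (∀ x ∈ orthant 3, DCS.map fam r μ x = x → x ≠ 0 →
      (1 - DCS.jac fam r μ x).det ≠ 0) ∧
    Set.Subsingleton {x ∈ intOrthant 3 | DCS.map fam r μ x = x} ∧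
    (∑ i : Fin 3, DCS.ind fam r μ (DCS.axial μ i))
      + 2 * (∑ᶠ v ∈ {v ∈ orthant 3 | DCS.map fam r μ v = v ∧
              ∃ k : Fin 3, v k = 0 ∧ ∀ j, j ≠ k → 0 < v j},
          DCS.ind fam r μ v)
      + 4 * (∑ᶠ p ∈ {p ∈ intOrthant 3 | DCS.map fam r μ p = p},
          DCS.ind fam r μ p) = 1 := by
  have key3 : ∀ k : Fin 3, ∃ i j : Fin 3, i ≠ j ∧ i ≠ k ∧ j ≠ k := by decide
  have hsub : ∀ k, (PS fam r μ k).Subsingleton := by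
    intro k
    obtain ⟨i, j, a, b, c⟩ := key3 k
    exact PS_sub fam r μ hr hμ hγ hplanar a b c
  have hQ := QS_sub fam r μ hr hμ hγ hplanar
  refine ⟨?_, ?_, hQ, ?_⟩
  · refine Set.Finite.subset (s := {0} ∪ (Set.range (DCS.axial μ) ∪ ((⋃ k, PS fam r μ k) ∪ QS fam r μ))) ?_ ?_
    · exact (Set.finite_singleton _).union ((Set.finite_range _).union
        ((Set.finite_iUnion fun k => (hsub k).finite).union hQ.finite))
    · rintro x ⟨hx, hf⟩
      rcases classify fam r μ hr hμ hx hf with h | ⟨i, h⟩ | ⟨k, h⟩ | h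
      · exact Or.inl h
      · exact Or.inr (Or.inl ⟨i, h.symm⟩)
      · exact Or.inr (Or.inr (Or.inl (Set.mem_iUnion.2 ⟨k, h⟩)))
      · exact Or.inr (Or.inr (Or.inr h))
  · intro x hx hf hx0
    obtain ⟨w, hw, h⟩ := det_red fam r μ hr hμ hx hf
    rw [h]
    refine mul_ne_zero hw.ne' ?_
    rcases classify fam r μ hr hμ hx hf with h | ⟨i, h⟩ | ⟨k, h⟩ | h
    · exact absurd h hx0
    · obtain ⟨j, k, a, b, c⟩ := key3 i
      have hs := axial_ind fam r μ hr hμ b.symm c.symm a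
      rw [← h, ind_red fam r μ hr hμ hx hf] at hs
      intro h0
      rw [h0, Real.sign_zero] at hs
      exact mul_ne_zero (hγ i j b.symm) (hγ i k c.symm) (Real.sign_eq_zero_iff.1 hs.symm)
    · obtain ⟨i, j, a, b, c⟩ := key3 k
      obtain ⟨-, -, -, -, h1, h2⟩ := PS_props fam r μ hr hμ hγ hplanar a b c h
      rw [h2]
      exact neg_ne_zero.2 h1
    · exact (QS_props fam r μ hr hμ hγ hplanar h).1
  · have hS : {v ∈ orthant 3 | DCS.map fam r μ v = v ∧
              ∃ k : Fin 3, v k = 0 ∧ ∀ j, j ≠ k → 0 < v j} =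
        (PS fam r μ 0 ∪ PS fam r μ 1) ∪ PS fam r μ 2 := by
      ext v
      constructor
      · rintro ⟨ho, hf, k, h⟩
        have : v ∈ PS fam r μ k := ⟨ho, hf, h⟩
        fin_cases k
        · exact Or.inl (Or.inl this)
        · exact Or.inl (Or.inr this)
        · exact Or.inr this
      · rintro ((h | h) | h)
        · exact ⟨h.1, h.2.1, 0, h.2.2⟩
        · exact ⟨h.1, h.2.1, 1, h.2.2⟩
        · exact ⟨h.1, h.2.1, 2, h.2.2⟩
    have hdis : ∀ k l : Fin 3, k ≠ l → Disjoint (PS fam r μ k) (PS fam r μ l) := by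
      intro k l hkl
      rw [Set.disjoint_left]
      intro v hv hw
      have := hw.2.2.2 k hkl
      rw [hv.2.2.1] at this
      exact lt_irrefl _ this
    have f : ∀ k, (PS fam r μ k).Finite := fun k => (hsub k).finite
    rw [hS, finsum_mem_union (Set.disjoint_union_left.2 ⟨hdis 0 2 (by decide), hdis 1 2 (by decide)⟩)
      ((f 0).union (f 1)) (f 2), finsum_mem_union (hdis 0 1 (by decide)) (f 0) (f 1)]
    obtain ⟨s0, n0⟩ := PS_sum fam r μ hr hμ hγ hplanar (i := 1) (j := 2) (k := 0) (by decide) (by decide) (by decide)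
    obtain ⟨s1, n1⟩ := PS_sum fam r μ hr hμ hγ hplanar (i := 0) (j := 2) (k := 1) (by decide) (by decide) (by decide)
    obtain ⟨s2, n2⟩ := PS_sum fam r μ hr hμ hγ hplanar (i := 0) (j := 1) (k := 2) (by decide) (by decide) (by decide)
    have sq := QS_sum fam r μ hr hμ hγ hplanar
    rw [QS] at sq
    rw [s0, s1, s2, sq, Fin.sum_univ_three,
      axial_ind fam r μ hr hμ (i := 0) (j := 1) (k := 2) (by decide) (by decide) (by decide),
      axial_ind fam r μ hr hμ (i := 1) (j := 0) (k := 2) (by decide) (by decide) (by decide),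
      axial_ind fam r μ hr hμ (i := 2) (j := 0) (k := 1) (by decide) (by decide) (by decide)]
    exact key_idx (μ 1 1 - μ 0 1) (μ 2 2 - μ 0 2) (μ 0 0 - μ 1 0) (μ 2 2 - μ 1 2) (μ 0 0 - μ 2 0)
      (μ 1 1 - μ 2 1) (hγ 1 0 (by decide)) (hγ 2 0 (by decide)) (hγ 0 1 (by decide))
      (hγ 2 1 (by decide)) (hγ 0 2 (by decide)) (hγ 1 2 (by decide)) (DD μ 1 2 0) (DD μ 0 2 1) (DD μ 0 1 2)
      (by rw [DD]) (by rw [DD]) (by rw [DD]) n0 n1 n2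
end

section
/- Let T ∈ DCS(3,f) satisfy γ₁₂ > 0, γ₁₃ > 0, γ₂₁ > 0, γ₃₂ > 0, γ₂₃ < 0, γ₃₁ < 0, and μ₃₁β₁₂ + μ₃₂β₂₁ < 1 (the conditions of class 29). Then T is permanent. -/
open Set Filter Metric Topology Polynomial

/-- βᵢⱼ = (μⱼⱼ − μᵢⱼ)/(μᵢᵢμⱼⱼ − μᵢⱼμⱼᵢ). -/
noncomputable def DCS.beta (μ : Fin 3 → Fin 3 → ℝ) (i j : Fin 3) : ℝ :=
  (μ j j - μ i j) / (μ i i * μ j j - μ i j * μ j i)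

theorem abs_perm {X : Type*} [TopologicalSpace X] [T2Space X] (B : Set X) (hB : IsCompact B)
    (hne : B.Nonempty)
    (T : X → X) (hT : ContinuousOn T B) (hTB : MapsTo T B B) (P ψ : X → ℝ)
    (hP : ContinuousOn P B) (hψ : ContinuousOn ψ B) (hP0 : ∀ x ∈ B, 0 ≤ P x)
    (hψ0 : ∀ x ∈ B, 0 < ψ x) (hPT : ∀ x ∈ B, P (T x) = ψ x * P x)
    (h : ∀ x ∈ B, P x = 0 → ∃ k, 1 ≤ k ∧ 1 < ∏ j ∈ Finset.range k, ψ (T^[j] x)) :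
    ∃ K : Set X, IsCompact K ∧ (∀ x ∈ K, x ∈ B ∧ 0 < P x) ∧ (∀ x ∈ K, T x ∈ K) ∧
      ∀ x ∈ B, 0 < P x → ∃ m, T^[m] x ∈ K := by
  have hit : ∀ n, MapsTo (T^[n]) B B := fun n => hTB.iterate n
  have hitc : ∀ n, ContinuousOn (T^[n]) B := fun n => hT.iterate hTB n
  have hprod : ∀ k, ∀ x ∈ B, P (T^[k] x) = (∏ j ∈ Finset.range k, ψ (T^[j] x)) * P x := by
    intro k x hx
    induction k with
    | zero => simp
    | succ k ih =>
      rw [Function.iterate_succ_apply', hPT _ (hit k hx), ih, Finset.prod_range_succ]; ring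
  have key : ∃ N : ℕ, 1 ≤ N ∧ ∃ ρ : ℝ, 1 < ρ ∧ ∃ p0 : ℝ, 0 < p0 ∧ ∀ y ∈ B, y ∈ B → (p0 ≤ P y ∨
      ∃ k, 1 ≤ k ∧ k ≤ N ∧ ρ * P y ≤ P (T^[k] y)) := by
    refine hB.induction_on (p := fun s => ∃ N : ℕ, 1 ≤ N ∧ ∃ ρ : ℝ, 1 < ρ ∧ ∃ p0 : ℝ, 0 < p0 ∧
      ∀ y ∈ s, y ∈ B → (p0 ≤ P y ∨ ∃ k, 1 ≤ k ∧ k ≤ N ∧ ρ * P y ≤ P (T^[k] y))) ?_ ?_ ?_ ?_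
    · exact ⟨1, le_rfl, 2, by norm_num, 1, by norm_num, by simp⟩
    · rintro s t hst ⟨N, hN, ρ, hρ, p0, hp0, hh⟩
      exact ⟨N, hN, ρ, hρ, p0, hp0, fun y hy => hh y (hst hy)⟩
    · rintro s t ⟨N, hN, ρ, hρ, p0, hp0, hh⟩ ⟨N', hN', ρ', hρ', p0', hp0', hh'⟩
      refine ⟨max N N', le_max_of_le_left hN, min ρ ρ', lt_min hρ hρ', min p0 p0',
        lt_min hp0 hp0', ?_⟩
      rintro y (hy | hy) hyB
      · rcases hh y hy hyB with h1 | ⟨k, hk1, hk2, hk3⟩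
        · exact Or.inl ((min_le_left _ _).trans h1)
        · exact Or.inr ⟨k, hk1, hk2.trans (le_max_left _ _),
            (mul_le_mul_of_nonneg_right (min_le_left _ _) (hP0 y hyB)).trans hk3⟩
      · rcases hh' y hy hyB with h1 | ⟨k, hk1, hk2, hk3⟩
        · exact Or.inl ((min_le_right _ _).trans h1)
        · exact Or.inr ⟨k, hk1, hk2.trans (le_max_right _ _),
            (mul_le_mul_of_nonneg_right (min_le_right _ _) (hP0 y hyB)).trans hk3⟩
    · intro x hx
      rcases (hP0 x hx).eq_or_lt with h0 | h0
      · obtain ⟨k, hk, hk1⟩ := h x hx h0.symm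
        obtain ⟨ρ, hρ1, hρ2⟩ := exists_between hk1
        have hc : ContinuousOn (fun y => ∏ j ∈ Finset.range k, ψ (T^[j] y)) B :=
          continuousOn_finsetProd _ fun j _ => hψ.comp (hitc j) (hit j)
        refine ⟨_, (hc x hx).eventually (lt_mem_nhds hρ2), k, hk, ρ, hρ1, 1, one_pos, ?_⟩
        intro y hy hyB
        refine Or.inr ⟨k, hk, le_rfl, ?_⟩
        rw [hprod k y hyB]
        exact mul_le_mul_of_nonneg_right (le_of_lt hy) (hP0 y hyB)
      · refine ⟨_, (hP x hx).eventually (lt_mem_nhds (half_lt_self h0)), 1, le_rfl, 2,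
          by norm_num, P x / 2, half_pos h0, ?_⟩
        intro y hy hyB
        exact Or.inl (le_of_lt hy)
  obtain ⟨N, hN, ρ, hρ, p0, hp0, hkey⟩ := key
  obtain ⟨c, hc0, hc1, hc⟩ : ∃ c : ℝ, 0 < c ∧ c ≤ 1 ∧ ∀ x ∈ B, c ≤ ψ x := by
    obtain ⟨x, hx, hm⟩ := hB.exists_isMinOn hne hψ
    exact ⟨min 1 (ψ x), lt_min one_pos (hψ0 x hx), min_le_left _ _,
      fun y hy => (min_le_right _ _).trans (hm hy)⟩
  have hlow : ∀ k, ∀ x ∈ B, c ^ k * P x ≤ P (T^[k] x) := by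
    intro k x hx
    rw [hprod k x hx]
    refine mul_le_mul_of_nonneg_right ?_ (hP0 x hx)
    calc c ^ k = ∏ j ∈ Finset.range k, c := by simp
      _ ≤ _ := Finset.prod_le_prod (fun _ _ => hc0.le) fun j _ => hc _ (hit j hx)
  set q := c * p0 with hq
  have hq0 : 0 < q := mul_pos hc0 hp0
  have hret : ∀ y ∈ B, q ≤ P y → ∃ k, 1 ≤ k ∧ k ≤ N ∧ q ≤ P (T^[k] y) := by
    intro y hy hqy
    rcases hkey y hy hy with h1 | ⟨k, hk1, hk2, hk3⟩
    · refine ⟨1, le_rfl, hN, ?_⟩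
      have := hlow 1 y hy
      rw [pow_one] at this
      exact (mul_le_mul_of_nonneg_left h1 hc0.le).trans this
    · refine ⟨k, hk1, hk2, ?_⟩
      nlinarith [hP0 y hy]
  have hstay : ∀ n, ∀ y ∈ B, q ≤ P y → c ^ N * q ≤ P (T^[n] y) := by
    intro n
    induction n using Nat.strong_induction_on with
    | _ n ih =>
      intro y hy hqy
      obtain ⟨k, hk1, hk2, hk3⟩ := hret y hy hqy
      rcases le_or_gt k n with hkn | hkn
      · have := ih (n - k) (by omega) (T^[k] y) (hit k hy) hk3
        rwa [← Function.iterate_add_apply, Nat.sub_add_cancel hkn] at this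
      · refine le_trans ?_ (hlow n y hy)
        exact mul_le_mul (pow_le_pow_of_le_one hc0.le hc1 (by omega)) hqy hq0.le
          (pow_nonneg hc0.le _)
  have hBc : IsClosed B := hB.isClosed
  have hcl : IsClosed (⋂ n : ℕ, B ∩ (fun y => P (T^[n] y)) ⁻¹' (Ici (c ^ N * q))) :=
    isClosed_iInter fun n =>
      (hP.comp (hitc n) (hit n)).preimage_isClosed_of_isClosed hBc isClosed_Ici
  refine ⟨_, hB.of_isClosed_subset hcl ?_, ?_, ?_, ?_⟩
  · exact fun y hy => (mem_iInter.1 hy 0).1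
  · intro x hx
    have := mem_iInter.1 hx 0
    exact ⟨this.1, lt_of_lt_of_le (mul_pos (pow_pos hc0 _) hq0) this.2⟩
  · intro x hx
    refine mem_iInter.2 fun n => ?_
    have h1 := mem_iInter.1 hx (n + 1)
    exact ⟨hTB h1.1, h1.2⟩
  · intro x hx hPx
    have : ∃ m, p0 ≤ P (T^[m] x) := by
      by_contra! hno
      have grow : ∀ n : ℕ, ∃ m, ρ ^ n * P x ≤ P (T^[m] x) := by
        intro n
        induction n with
        | zero => exact ⟨0, by simp⟩
        | succ n ih =>
          obtain ⟨m, hm⟩ := ih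
          rcases hkey _ (hit m hx) (hit m hx) with h1 | ⟨k, _, _, hk3⟩
          · exact absurd h1 (not_le.2 (hno m))
          · refine ⟨k + m, ?_⟩
            rw [Function.iterate_add_apply]
            refine le_trans ?_ hk3
            rw [pow_succ]
            nlinarith
      obtain ⟨n, hn⟩ := pow_unbounded_of_one_lt (p0 / P x) hρ
      obtain ⟨m, hm⟩ := grow n
      rw [div_lt_iff₀ hPx] at hn
      linarith [hno m]
    obtain ⟨m, hm⟩ := this
    refine ⟨m, mem_iInter.2 fun n => ⟨hit m hx, hstay n _ (hit m hx) ?_⟩⟩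
    nlinarith

structure GP (g : ℝ → ℝ) : Prop where
  cont : ContinuousOn g (Ici 0)
  pos : ∀ s, 0 ≤ s → 0 < g s
  anti : StrictAntiOn g (Ici 0)
  mono : StrictMonoOn (fun s => s * g s) (Ici 0)
  one : g 1 = 1

theorem GP.of (F : GrowthF) (r : ℝ) (hr : 0 < r) : GP (fun s => F.f (r * s) r) := by
  have hc : ContinuousOn (fun w => F.f w r) (Ici 0) :=
    fun z hz => (F.hasDeriv z r hz hr).continuousWithinAt
  have hd : ∀ z, 0 < z → HasDerivAt (fun w => F.f w r) (F.fz z r) z :=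
    fun z hz => (F.hasDeriv z r hz.le hr).hasDerivAt (Ici_mem_nhds hz)
  have ha : StrictAntiOn (fun w => F.f w r) (Ici 0) := by
    refine strictAntiOn_of_deriv_neg (convex_Ici 0) hc fun z hz => ?_
    rw [interior_Ici] at hz
    rw [(hd z hz).deriv]
    exact F.fz_neg z r (le_of_lt hz) hr
  have hm : StrictMonoOn (fun w => w * F.f w r) (Ici 0) := by
    refine strictMonoOn_of_deriv_pos (convex_Ici 0) (continuousOn_id.mul hc) fun z hz => ?_
    rw [interior_Ici] at hz
    have := ((hasDerivAt_id z).mul (hd z hz)).deriv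
    have h2 : deriv (fun w => w * F.f w r) z = 1 * F.f z r + z * F.fz z r := this
    rw [h2, one_mul]
    exact F.contest z r (le_of_lt hz) hr
  have hmem : ∀ s ∈ Ici (0 : ℝ), r * s ∈ Ici (0 : ℝ) := fun s hs => mul_nonneg hr.le hs
  refine ⟨?_, fun s hs => F.pos _ _ (hmem s hs) hr, ?_, ?_, ?_⟩
  · exact hc.comp (continuous_const.mul continuous_id).continuousOn hmem
  · intro s hs t ht hst
    exact ha (hmem s hs) (hmem t ht) (mul_lt_mul_of_pos_left hst hr)
  · intro s hs t ht hst
    have := hm (hmem s hs) (hmem t ht) (mul_lt_mul_of_pos_left hst hr)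
    simp only at this ⊢
    rw [mul_assoc, mul_assoc] at this
    exact lt_of_mul_lt_mul_left this hr.le
  · simpa using F.unit r hr

namespace GP
variable {g h : ℝ → ℝ}

theorem gt_one (hg : GP g) {s : ℝ} (h0 : 0 ≤ s) (h1 : s < 1) : 1 < g s := by
  have := hg.anti (mem_Ici.2 h0) (mem_Ici.2 zero_le_one) h1
  rwa [hg.one] at this

theorem lt_one (hg : GP g) {s : ℝ} (h1 : 1 < s) : g s < 1 := by
  have := hg.anti (mem_Ici.2 zero_le_one) (mem_Ici.2 (zero_le_one.trans h1.le)) h1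
  rwa [hg.one] at this

theorem ge_one (hg : GP g) {s : ℝ} (h0 : 0 ≤ s) (h1 : s ≤ 1) : 1 ≤ g s := by
  rcases h1.eq_or_lt with rfl | h1
  · exact hg.one.ge
  · exact (hg.gt_one h0 h1).le

theorem le_one (hg : GP g) {s : ℝ} (h1 : 1 ≤ s) : g s ≤ 1 := by
  rcases h1.eq_or_lt with rfl | h1
  · exact hg.one.le
  · exact (hg.lt_one h1).le

theorem eq_one (hg : GP g) {s : ℝ} (h0 : 0 ≤ s) (h1 : g s = 1) : s = 1 := by
  rcases lt_trichotomy s 1 with h | h | h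
  · exact absurd h1 (hg.gt_one h0 h).ne'
  · exact h
  · exact absurd h1 (hg.lt_one h).ne

theorem fix (hg : GP g) {u s : ℝ} (h0 : 0 ≤ s) (h1 : u = u * g s) (hu : 0 < u) : s = 1 := by
  refine hg.eq_one h0 ?_
  have : u * (g s - 1) = 0 := by linarith
  rcases mul_eq_zero.1 this with h | h <;> linarith

theorem cmp (hg : GP g) {a b : ℝ} (ha : 0 < a) (hb : 0 < b) {u v u' v' : ℝ} (hu : 0 ≤ u)
    (huu : u ≤ u') (hv : 0 ≤ v') (hvv : v' ≤ v) :
    u * g (a * u + b * v) ≤ u' * g (a * u' + b * v') := by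
  have e1 : 0 ≤ a * u := by positivity
  have e2 : 0 ≤ b * v' := by positivity
  have e3 : b * v' ≤ b * v := by gcongr
  have e4 : a * u ≤ a * u' := by gcongr
  have h1 : g (a * u + b * v) ≤ g (a * u + b * v') :=
    hg.anti.antitoneOn (mem_Ici.2 (by linarith)) (mem_Ici.2 (by linarith)) (by linarith)
  have h2 : g (a * u' + b * v') ≤ g (a * u + b * v') :=
    hg.anti.antitoneOn (mem_Ici.2 (by linarith)) (mem_Ici.2 (by linarith)) (by linarith)
  have h3 : (a * u + b * v') * g (a * u + b * v') ≤ (a * u' + b * v') * g (a * u' + b * v') :=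
    hg.mono.monotoneOn (mem_Ici.2 (by linarith)) (mem_Ici.2 (by linarith)) (by linarith)
  have h4 := mul_le_mul_of_nonneg_left h2 e2
  have h5 : a * (u * g (a * u + b * v')) ≤ a * (u' * g (a * u' + b * v')) := by nlinarith
  exact (mul_le_mul_of_nonneg_left h1 hu).trans (le_of_mul_le_mul_left h5 ha)
end GP

/-- `u, v` is an orbit of the planar competition map. -/
structure Orb (g h : ℝ → ℝ) (a b c d : ℝ) (u v : ℕ → ℝ) : Prop where
  u0 : 0 ≤ u 0
  v0 : 0 ≤ v 0
  us : ∀ n, u (n + 1) = u n * g (a * u n + b * v n)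
  vs : ∀ n, v (n + 1) = v n * h (c * u n + d * v n)

section planar
variable {g h : ℝ → ℝ} {a b c d : ℝ}

theorem Orb.swap {u v : ℕ → ℝ} (o : Orb g h a b c d u v) : Orb h g d c b a v u :=
  ⟨o.v0, o.u0, fun n => by rw [o.vs, add_comm], fun n => by rw [o.us, add_comm]⟩

theorem Orb.nonneg (hg : GP g) (hh : GP h) (ha : 0 < a) (hb : 0 < b) (hc : 0 < c) (hd : 0 < d)
    {u v : ℕ → ℝ} (o : Orb g h a b c d u v) (n : ℕ) : 0 ≤ u n ∧ 0 ≤ v n := by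
  induction n with
  | zero => exact ⟨o.u0, o.v0⟩
  | succ n ih =>
    obtain ⟨h1, h2⟩ := ih
    rw [o.us, o.vs]
    exact ⟨mul_nonneg h1 (hg.pos _ (by positivity)).le,
      mul_nonneg h2 (hh.pos _ (by positivity)).le⟩

theorem Orb.cmp (hg : GP g) (hh : GP h) (ha : 0 < a) (hb : 0 < b) (hc : 0 < c) (hd : 0 < d)
    {u v u' v' : ℕ → ℝ} (o : Orb g h a b c d u v) (o' : Orb g h a b c d u' v')
    (hu : u 0 ≤ u' 0) (hv : v' 0 ≤ v 0) (n : ℕ) : u n ≤ u' n ∧ v' n ≤ v n := by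
  induction n with
  | zero => exact ⟨hu, hv⟩
  | succ n ih =>
    obtain ⟨h1, h2⟩ := o.nonneg hg hh ha hb hc hd n
    obtain ⟨h1', h2'⟩ := o'.nonneg hg hh ha hb hc hd n
    rw [o.us, o.vs, o'.us, o'.vs]
    refine ⟨hg.cmp ha hb h1 ih.1 h2' ih.2, ?_⟩
    have := hh.cmp hd hc h2' ih.2 h1 ih.1
    rwa [add_comm (d * _), add_comm (d * _)] at this

theorem Orb.exists (hg : GP g) (hh : GP h) (u0 v0 : ℝ) (hu : 0 ≤ u0) (hv : 0 ≤ v0) :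
    ∃ u v : ℕ → ℝ, Orb g h a b c d u v ∧ u 0 = u0 ∧ v 0 = v0 := by
  let Φ : ℝ × ℝ → ℝ × ℝ := fun p => (p.1 * g (a * p.1 + b * p.2), p.2 * h (c * p.1 + d * p.2))
  refine ⟨fun n => (Φ^[n] (u0, v0)).1, fun n => (Φ^[n] (u0, v0)).2, ⟨hu, hv, ?_, ?_⟩, rfl, rfl⟩
  · intro n
    simp only [Function.iterate_succ_apply']
    rfl
  · intro n
    simp only [Function.iterate_succ_apply']
    rfl

theorem Orb.mono (hg : GP g) (hh : GP h) (ha : 0 < a) (hb : 0 < b) (hc : 0 < c) (hd : 0 < d)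
    {u v : ℕ → ℝ} (o : Orb g h a b c d u v) (hu : u 0 ≤ u 1) (hv : v 1 ≤ v 0) :
    Monotone u ∧ Antitone v := by
  have o' : Orb g h a b c d (fun n => u (n + 1)) (fun n => v (n + 1)) :=
    ⟨(o.nonneg hg hh ha hb hc hd 1).1, (o.nonneg hg hh ha hb hc hd 1).2, fun n => o.us _,
      fun n => o.vs _⟩
  have := o.cmp hg hh ha hb hc hd o' hu hv
  exact ⟨monotone_nat_of_le_succ fun n => (this n).1, antitone_nat_of_succ_le fun n => (this n).2⟩

theorem Orb.lim (hg : GP g) (hh : GP h) (ha : 0 < a) (hb : 0 < b) (hc : 0 < c) (hd : 0 < d)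
    {u v : ℕ → ℝ} (o : Orb g h a b c d u v) (hu : u 0 ≤ u 1) (hv : v 1 ≤ v 0) (U : ℝ)
    (hU : ∀ n, u n ≤ U) :
    ∃ p q, Tendsto u atTop (𝓝 p) ∧ Tendsto v atTop (𝓝 q) ∧ p = p * g (a * p + b * q) ∧
      q = q * h (c * p + d * q) := by
  obtain ⟨hm, hm'⟩ := o.mono hg hh ha hb hc hd hu hv
  have nn := o.nonneg hg hh ha hb hc hd
  have hp := tendsto_atTop_ciSup hm ⟨U, by rintro _ ⟨n, rfl⟩; exact hU n⟩
  have hq := tendsto_atTop_ciInf hm' ⟨0, by rintro _ ⟨n, rfl⟩; exact (nn n).2⟩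
  set p := ⨆ i, u i
  set q := ⨅ i, v i
  have hp0 : 0 ≤ p := ge_of_tendsto' hp fun n => (nn n).1
  have hq0 : 0 ≤ q := ge_of_tendsto' hq fun n => (nn n).2
  have cv : ∀ {k : ℝ → ℝ} {s t : ℝ}, GP k → 0 < s → 0 < t →
      Tendsto (fun n => k (s * u n + t * v n)) atTop (𝓝 (k (s * p + t * q))) := by
    intro k s t hk hs ht
    have h1 : Tendsto (fun n => s * u n + t * v n) atTop (𝓝 (s * p + t * q)) :=
      (hp.const_mul s).add (hq.const_mul t)
    refine (hk.cont (s * p + t * q) (mem_Ici.2 (by positivity))).tendsto.comp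
      (tendsto_nhdsWithin_iff.2 ⟨h1, Eventually.of_forall fun n => ?_⟩)
    have := nn n
    exact add_nonneg (mul_nonneg hs.le this.1) (mul_nonneg ht.le this.2)
  refine ⟨p, q, hp, hq, ?_, ?_⟩
  · refine tendsto_nhds_unique ((tendsto_add_atTop_iff_nat 1).2 hp) ?_
    simp only [o.us]
    exact hp.mul (cv hg ha hb)
  · refine tendsto_nhds_unique ((tendsto_add_atTop_iff_nat 1).2 hq) ?_
    simp only [o.vs]
    exact hq.mul (cv hh hc hd)

theorem Orb.conv (hg : GP g) (hh : GP h) (ha : 0 < a) (hb : 0 < b) (hc : 0 < c) (hd : 0 < d)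
    {u v : ℕ → ℝ} (o : Orb g h a b c d u v) (u0 v0 U V p q : ℝ) (hu0 : 0 ≤ u0) (hV : 0 ≤ V)
    (h1 : u0 ≤ u 0) (h2 : u 0 ≤ U) (h3 : V ≤ v 0) (h4 : v 0 ≤ v0)
    (s1 : u0 ≤ u0 * g (a * u0 + b * v0)) (s2 : v0 * h (c * u0 + d * v0) ≤ v0)
    (t1 : U * g (a * U + b * V) ≤ U) (t2 : V ≤ V * h (c * U + d * V))
    (uniq : ∀ x y, u0 ≤ x → V ≤ y → y ≤ v0 → x = x * g (a * x + b * y) → y = y * h (c * x + d * y) →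
      x = p ∧ y = q) :
    Tendsto u atTop (𝓝 p) ∧ Tendsto v atTop (𝓝 q) := by
  obtain ⟨x, y, oxy, hx, hy⟩ := Orb.exists (a := a) (b := b) (c := c) (d := d) hg hh u0 v0 hu0
    (hV.trans (h3.trans h4))
  obtain ⟨z, w, ozw, hz, hw⟩ := Orb.exists (a := a) (b := b) (c := c) (d := d) hg hh U V
    (hu0.trans (h1.trans h2)) hV
  have c1 := oxy.cmp hg hh ha hb hc hd o (by rw [hx]; exact h1) (by rw [hy]; exact h4)
  have c2 := o.cmp hg hh ha hb hc hd ozw (by rw [hz]; exact h2) (by rw [hw]; exact h3)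
  have x1 : x 0 ≤ x 1 := by rw [oxy.us 0, hx, hy]; exact s1
  have y1 : y 1 ≤ y 0 := by rw [oxy.vs 0, hx, hy]; exact s2
  have z1 : z 1 ≤ z 0 := by rw [ozw.us 0, hz, hw]; exact t1
  have w1 : w 0 ≤ w 1 := by rw [ozw.vs 0, hz, hw]; exact t2
  have m1 := oxy.mono hg hh ha hb hc hd x1 y1
  have m2 := ozw.swap.mono hh hg hd hc hb ha w1 z1
  have bx : ∀ n, u0 ≤ x n := fun n => hx ▸ m1.1 (Nat.zero_le n)
  have bw : ∀ n, V ≤ w n := fun n => hw ▸ m2.1 (Nat.zero_le n)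
  have by' : ∀ n, y n ≤ v0 := fun n => hy ▸ m1.2 (Nat.zero_le n)
  have bz : ∀ n, z n ≤ U := fun n => hz ▸ m2.2 (Nat.zero_le n)
  obtain ⟨p1, q1, l1, l2, f1, f2⟩ := oxy.lim hg hh ha hb hc hd x1 y1 U
    fun n => ((c1 n).1.trans (c2 n).1).trans (bz n)
  obtain ⟨q2, p2, l3, l4, f3, f4⟩ := ozw.swap.lim hh hg hd hc hb ha w1 z1 v0
    fun n => ((c2 n).2.trans (c1 n).2).trans (by' n)
  rw [add_comm] at f3 f4
  obtain ⟨e1, e2⟩ := uniq p1 q1 (ge_of_tendsto' l1 bx)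
    (ge_of_tendsto' l2 fun n => ((bw n).trans (c2 n).2).trans (c1 n).2) (le_of_tendsto' l2 by') f1 f2
  obtain ⟨e3, e4⟩ := uniq p2 q2 (ge_of_tendsto' l4 fun n => ((bx n).trans (c1 n).1).trans (c2 n).1)
    (ge_of_tendsto' l3 bw)
    (le_of_tendsto' l3 fun n => ((c2 n).2.trans (c1 n).2).trans (by' n)) f4 f3
  subst e1 e2 e3 e4
  exact ⟨tendsto_of_tendsto_of_tendsto_of_le_of_le l1 l4 (fun n => (c1 n).1) fun n => (c2 n).1,
    tendsto_of_tendsto_of_tendsto_of_le_of_le l3 l2 (fun n => (c2 n).2) fun n => (c1 n).2⟩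

theorem small_eps {x A B : ℝ} (hx : 0 < x) (hA : 0 < A) (hB : B < 1) :
    ∃ e, 0 < e ∧ e ≤ x ∧ A * e + B ≤ 1 := by
  refine ⟨min x ((1 - B) / A), lt_min hx (div_pos (by linarith) hA), min_le_left _ _, ?_⟩
  have : A * min x ((1 - B) / A) ≤ A * ((1 - B) / A) :=
    mul_le_mul_of_nonneg_left (min_le_right _ _) hA.le
  rw [mul_div_cancel₀ _ hA.ne'] at this
  linarith

/-- species `u` dominates, or `v = 0`. -/
theorem Orb.dominance (hg : GP g) (hh : GP h) (ha : 0 < a) (hb : 0 < b) (hc : 0 < c) (hd : 0 < d)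
    {u v : ℕ → ℝ} (o : Orb g h a b c d u v) (U v0 : ℝ) (hu : 0 < u 0) (hU : u 0 ≤ U)
    (haU : 1 ≤ a * U) (hv0 : v 0 ≤ v0) (hbv : b * v0 < 1) (hdv : v0 = 0 ∨ (1 ≤ d * v0 ∧
      a < c ∧ b < d)) :
    Tendsto u atTop (𝓝 (1 / a)) ∧ Tendsto v atTop (𝓝 0) := by
  obtain ⟨e, he, hex, he1⟩ := small_eps hu ha hbv
  have hv0' : 0 ≤ v0 := o.v0.trans hv0
  refine o.conv hg hh ha hb hc hd e v0 U 0 _ _ he.le le_rfl hex hU o.v0 hv0 ?_ ?_ ?_ ?_ ?_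
  · exact le_mul_of_one_le_right he.le (hg.ge_one (by positivity) he1)
  · rcases hdv with rfl | ⟨hdv, -, -⟩
    · simp
    · exact mul_le_of_le_one_right hv0' (hh.le_one (by nlinarith [mul_pos hc he]))
  · exact mul_le_of_le_one_right (hu.le.trans hU) (hg.le_one (by linarith))
  · simp
  · intro x y hx hy hyv fx fy
    have hx0 : 0 < x := he.trans_le hx
    have k1 := hg.fix (by positivity) fx hx0
    rcases hy.eq_or_lt with rfl | hy
    · refine ⟨?_, rfl⟩
      rw [eq_div_iff ha.ne']; linarith
    · exfalso
      rcases hdv with rfl | ⟨hdv, hac, hbd⟩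
      · linarith
      · have k2 := hh.fix (by positivity) fy hy
        nlinarith

theorem Orb.coex (hg : GP g) (hh : GP h) (ha : 0 < a) (hb : 0 < b) (hc : 0 < c) (hd : 0 < d)
    {u v : ℕ → ℝ} (o : Orb g h a b c d u v) (U v0 : ℝ) (hu : 0 < u 0) (hU : u 0 ≤ U)
    (hv : 0 < v 0) (hv0 : v 0 ≤ v0)
    (haU : 1 ≤ a * U) (hcU : c * U < 1) (hbv : b * v0 < 1) (hdv : 1 ≤ d * v0)
    (hac : c < a) (hbd : b < d) :
    Tendsto u atTop (𝓝 ((d - b) / (a * d - b * c))) ∧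
      Tendsto v atTop (𝓝 ((a - c) / (d * a - c * b))) := by
  obtain ⟨e, he, hex, he1⟩ := small_eps hu ha hbv
  obtain ⟨e', he', hex', he1'⟩ := small_eps hv hd hcU
  have hU0 : 0 < U := hu.trans_le hU
  have hv00 : 0 < v0 := hv.trans_le hv0
  have hD : 0 < a * d - b * c := by nlinarith [mul_pos ha (sub_pos.2 hbd)]
  refine o.conv hg hh ha hb hc hd e v0 U e' _ _ he.le he'.le hex hU hex' hv0 ?_ ?_ ?_ ?_ ?_
  · exact le_mul_of_one_le_right he.le (hg.ge_one (by positivity) he1)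
  · exact mul_le_of_le_one_right hv00.le (hh.le_one (by nlinarith [mul_pos hc he]))
  · exact mul_le_of_le_one_right hU0.le (hg.le_one (by nlinarith [mul_pos hb he']))
  · exact le_mul_of_one_le_right he'.le (hh.ge_one (by positivity) (by linarith))
  · intro x y hx hy hyv fx fy
    have hx0 : 0 < x := he.trans_le hx
    have hy0 : 0 < y := he'.trans_le hy
    have k1 := hg.fix (by positivity) fx hx0
    have k2 := hh.fix (by positivity) fy hy0
    constructor
    · rw [eq_div_iff hD.ne']
      linear_combination d * k1 - b * k2
    · rw [eq_div_iff (by nlinarith)]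
      linear_combination a * k2 - c * k1
end planar

theorem prod_gt {w : ℕ → ℝ} {L : ℝ} (hw : ∀ n, 0 < w n) (hL : Tendsto w atTop (𝓝 L))
    (h1 : 1 < L) : ∃ k, 1 ≤ k ∧ 1 < ∏ j ∈ Finset.range k, w j := by
  obtain ⟨ρ, hρ, hρL⟩ := exists_between h1
  obtain ⟨N, hN⟩ := eventually_atTop.1 (hL.eventually (lt_mem_nhds hρL))
  set C := ∏ j ∈ Finset.range N, w j with hC
  have hC0 : 0 < C := Finset.prod_pos fun j _ => hw j
  have key : ∀ m, C * ρ ^ m ≤ ∏ j ∈ Finset.range (N + m), w j := by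
    intro m
    induction m with
    | zero => simp [hC]
    | succ m ih =>
      rw [← add_assoc, Finset.prod_range_succ, pow_succ, ← mul_assoc]
      exact mul_le_mul ih (hN _ (by omega)).le (by linarith)
        (Finset.prod_nonneg fun j _ => (hw j).le)
  obtain ⟨m, hm⟩ := pow_unbounded_of_one_lt (1 / C) hρ
  rw [div_lt_iff₀ hC0] at hm
  have hgt : 1 < ∏ j ∈ Finset.range (N + m), w j := by
    have := key m
    nlinarith
  refine ⟨N + m, ?_, hgt⟩
  by_contra hk
  have : N + m = 0 := by omega
  rw [this] at hgt
  simp at hgt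

/-- growth function of a single species, in the rescaled variable -/
def gr (fam : Fin 3 → GrowthF) (r : Fin 3 → ℝ) (i : Fin 3) (s : ℝ) : ℝ :=
  (fam i).f (r i * s) (r i)

theorem map_eq (fam : Fin 3 → GrowthF) (r : Fin 3 → ℝ) (μ : Fin 3 → Fin 3 → ℝ)
    (x : Fin 3 → ℝ) (i : Fin 3) :
    DCS.map fam r μ x i = x i * gr fam r i (∑ j, μ i j * x j) := rfl

theorem face_orb (fam : Fin 3 → GrowthF) (r : Fin 3 → ℝ) (μ : Fin 3 → Fin 3 → ℝ)
    (x : Fin 3 → ℝ) (hx : ∀ i, 0 ≤ x i) (i j k : Fin 3)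
    (hsum : ∀ (y : Fin 3 → ℝ) (l : Fin 3),
      ∑ m, μ l m * y m = μ l i * y i + μ l j * y j + μ l k * y k) (hk : x k = 0) :
    Orb (gr fam r i) (gr fam r j) (μ i i) (μ i j) (μ j i) (μ j j)
      (fun n => (DCS.map fam r μ)^[n] x i) (fun n => (DCS.map fam r μ)^[n] x j) ∧
      ∀ n, (DCS.map fam r μ)^[n] x k = 0 := by
  have hz : ∀ n, (DCS.map fam r μ)^[n] x k = 0 := by
    intro n
    induction n with
    | zero => exact hk
    | succ n ih => rw [Function.iterate_succ_apply', map_eq, ih, zero_mul]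
  refine ⟨⟨hx i, hx j, fun n => ?_, fun n => ?_⟩, hz⟩
  · simp only [Function.iterate_succ_apply', map_eq, hsum, hz n, mul_zero, add_zero]
  · simp only [Function.iterate_succ_apply', map_eq, hsum, hz n, mul_zero, add_zero]

theorem exists_M {a m : ℝ} (hm : 0 < m) (h : m < a) : ∃ M, 0 < M ∧ 1 < a * M ∧ m * M < 1 := by
  have : 0 < a + m := by linarith
  refine ⟨2 / (a + m), by positivity, ?_, ?_⟩
  · rw [mul_div_assoc', lt_div_iff₀ this]; linarith
  · rw [mul_div_assoc', div_lt_iff₀ this]; linarith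

theorem exists_exp {y z : ℝ} (hy : 1 < y) (hz : 0 < z) : ∃ n : ℕ, 1 < y ^ (n + 1) * z := by
  obtain ⟨n, hn⟩ := pow_unbounded_of_one_lt (1 / z) hy
  refine ⟨n, ?_⟩
  rw [← div_lt_iff₀ hz]
  exact hn.trans_le (pow_le_pow_right₀ hy.le (Nat.le_succ n))

theorem tend3 {s : ℕ → Fin 3 → ℝ} {p : Fin 3 → ℝ} (h0 : Tendsto (fun n => s n 0) atTop (𝓝 (p 0)))
    (h1 : Tendsto (fun n => s n 1) atTop (𝓝 (p 1)))
    (h2 : Tendsto (fun n => s n 2) atTop (𝓝 (p 2))) : Tendsto s atTop (𝓝 p) := by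
  refine tendsto_pi_nhds.2 fun i => ?_
  fin_cases i
  exacts [h0, h1, h2]

/-- Class 29: for T ∈ DCS(3,f) with γ₁₂, γ₁₃, γ₂₁, γ₃₂ > 0,
γ₂₃, γ₃₁ < 0 and μ₃₁β₁₂ + μ₃₂β₂₁ < 1, the map T is permanent. -/
theorem stmt18 (fam : Fin 3 → GrowthF) (r : Fin 3 → ℝ) (μ : Fin 3 → Fin 3 → ℝ)
    (hr : ∀ i, 0 < r i) (hμ : ∀ i j, 0 < μ i j)
    (hγ12 : 0 < μ 0 0 - μ 1 0) (hγ13 : 0 < μ 0 0 - μ 2 0)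
    (hγ21 : 0 < μ 1 1 - μ 0 1) (hγ32 : 0 < μ 2 2 - μ 1 2)
    (hγ23 : μ 1 1 - μ 2 1 < 0) (hγ31 : μ 2 2 - μ 0 2 < 0)
    (hβ : μ 2 0 * DCS.beta μ 0 1 + μ 2 1 * DCS.beta μ 1 0 < 1) :
    Permanent (DCS.map fam r μ) := by
  have hG : ∀ i, GP (gr fam r i) := fun i => GP.of (fam i) (r i) (hr i)
  obtain ⟨M0, hM0, hM01, hM0m⟩ := exists_M (a := μ 0 0) (m := max (μ 1 0) (μ 2 0))
    (lt_max_of_lt_left (hμ _ _)) (max_lt (by linarith) (by linarith))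
  obtain ⟨M1, hM1, hM11, hM1m⟩ := exists_M (a := μ 1 1) (m := μ 0 1) (hμ _ _) (by linarith)
  obtain ⟨M2, hM2, hM21, hM2m⟩ := exists_M (a := μ 2 2) (m := μ 1 2) (hμ _ _) (by linarith)
  have hM010 : μ 1 0 * M0 < 1 :=
    (mul_le_mul_of_nonneg_right (le_max_left _ _) hM0.le).trans_lt hM0m
  have hM020 : μ 2 0 * M0 < 1 :=
    (mul_le_mul_of_nonneg_right (le_max_right _ _) hM0.le).trans_lt hM0m
  clear hM0m
  set T := DCS.map fam r μ with hTdef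
  have hTe : ∀ x i, T x i = x i * gr fam r i (∑ j, μ i j * x j) := fun _ _ => rfl
  obtain ⟨M, hMdef⟩ : ∃ M : Fin 3 → ℝ, M = ![M0, M1, M2] := ⟨_, rfl⟩
  have hMp : ∀ i, 0 < M i ∧ 1 < μ i i * M i := by
    intro i; subst hMdef; fin_cases i
    exacts [⟨hM0, hM01⟩, ⟨hM1, hM11⟩, ⟨hM2, hM21⟩]
  have hs0 : ∀ (x : Fin 3 → ℝ), (∀ i, 0 ≤ x i) → ∀ i, 0 ≤ ∑ j, μ i j * x j := fun x hx i =>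
    Finset.sum_nonneg fun j _ => mul_nonneg (hμ i j).le (hx j)
  -- one coordinate comparison
  have hcmp : ∀ (x : Fin 3 → ℝ), (∀ i, 0 ≤ x i) → ∀ i w, x i ≤ w →
      T x i ≤ w * gr fam r i (μ i i * w) := by
    intro x hx i w hw
    have h1 := (hG i).cmp (hμ i i) one_pos (u := x i) (u' := w) (v' := 0)
      (v := ∑ j ∈ Finset.univ.erase i, μ i j * x j) (hx i) hw le_rfl
      (Finset.sum_nonneg fun j _ => mul_nonneg (hμ i j).le (hx j))
    rw [one_mul, Finset.add_sum_erase _ (fun j => μ i j * x j) (Finset.mem_univ i), mul_zero, add_zero] at h1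
    exact h1
  have hTnn : ∀ (x : Fin 3 → ℝ), (∀ i, 0 ≤ x i) → ∀ i, 0 ≤ T x i := fun x hx i =>
    mul_nonneg (hx i) ((hG i).pos _ (hs0 x hx i)).le
  have hTpos : ∀ (x : Fin 3 → ℝ), (∀ i, 0 < x i) → ∀ i, 0 < T x i := fun x hx i =>
    mul_pos (hx i) ((hG i).pos _ (hs0 x (fun i => (hx i).le) i))
  have hitpos : ∀ (x : Fin 3 → ℝ), (∀ i, 0 < x i) → ∀ n i, 0 < T^[n] x i := by
    intro x hx n
    induction n with
    | zero => exact hx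
    | succ n ih => rw [Function.iterate_succ_apply']; exact hTpos _ ih
  have hB : IsCompact (Icc (0 : Fin 3 → ℝ) M) := isCompact_Icc
  have hTB : MapsTo T (Icc 0 M) (Icc 0 M) := by
    intro x hx
    refine ⟨fun i => hTnn x hx.1 i, fun i => (hcmp x hx.1 i (M i) (hx.2 i)).trans ?_⟩
    exact mul_le_of_le_one_right (hMp i).1.le ((hG i).le_one (hMp i).2.le)
  have hgc : ∀ i, ContinuousOn (fun x : Fin 3 → ℝ => gr fam r i (∑ j, μ i j * x j)) (Icc 0 M) := by
    intro i
    refine (hG i).cont.comp (Continuous.continuousOn (by fun_prop)) ?_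
    intro x hx
    exact hs0 x hx.1 i
  have hTc : ContinuousOn T (Icc 0 M) :=
    continuousOn_pi.2 fun i => (continuous_apply i).continuousOn.mul (hgc i)
  -- exponents
  have hq : ∀ i j, 0 ≤ μ i j * (1 / μ j j) := fun i j =>
    mul_nonneg (hμ _ _).le (one_div_pos.2 (hμ _ _)).le
  have hqlt : ∀ i j, μ i j < μ j j → 1 < gr fam r i (μ i j * (1 / μ j j)) := by
    intro i j hij
    refine (hG i).gt_one (hq i j) ?_
    rw [mul_one_div, div_lt_one (hμ _ _)]; exact hij
  have hqeq : ∀ i, gr fam r i (μ i i * (1 / μ i i)) = 1 := by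
    intro i
    rw [mul_one_div, div_self (hμ _ _).ne']; exact (hG i).one
  obtain ⟨A, hA⟩ := exists_exp (hqlt 0 1 (by linarith)) ((hG 2).pos _ (hq 2 1))
  obtain ⟨C, hC⟩ := exists_exp (hqlt 1 2 (by linarith))
    (pow_pos ((hG 0).pos _ (hq 0 2)) (A + 1))
  obtain ⟨ψ, hψdef⟩ : ∃ ψ : (Fin 3 → ℝ) → ℝ, ψ = fun x =>
    gr fam r 0 (∑ j, μ 0 j * x j) ^ (A + 1) * gr fam r 1 (∑ j, μ 1 j * x j) ^ (C + 1) *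
      gr fam r 2 (∑ j, μ 2 j * x j) := ⟨_, rfl⟩
  have hψc : ContinuousOn ψ (Icc 0 M) := by
    rw [hψdef]
    exact (((hgc 0).pow _).mul ((hgc 1).pow _)).mul (hgc 2)
  have hψ0 : ∀ x ∈ Icc 0 M, 0 < ψ x := by
    intro x hx
    have := fun i => (hG i).pos _ (hs0 x hx.1 i)
    rw [hψdef]
    exact mul_pos (mul_pos (pow_pos (this 0) _) (pow_pos (this 1) _)) (this 2)
  have hbd : ∀ x ∈ Icc 0 M, (x 0 = 0 ∨ x 1 = 0 ∨ x 2 = 0) →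
      ∃ p, Tendsto (fun n => T^[n] x) atTop (𝓝 p) ∧ 1 < ψ p := by
    intro x hx hx0
    have hxM0 : x 0 ≤ M0 := by simpa [hMdef] using hx.2 0
    have hxM1 : x 1 ≤ M1 := by simpa [hMdef] using hx.2 1
    have hxM2 : x 2 ≤ M2 := by simpa [hMdef] using hx.2 2
    -- species 1 beats species 2 (0 absent)
    have caseB : x 0 = 0 → 0 < x 1 → ∃ p, Tendsto (fun n => T^[n] x) atTop (𝓝 p) ∧ 1 < ψ p := by
      intro h0 h1
      obtain ⟨o, oz⟩ := face_orb fam r μ x hx.1 1 2 0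
        (fun y l => by rw [Fin.sum_univ_three]; ring) h0
      obtain ⟨l1, l2⟩ := o.dominance (hG 1) (hG 2) (hμ _ _) (hμ _ _) (hμ _ _) (hμ _ _) M1 M2
        h1 hxM1 hM11.le hxM2 hM2m (Or.inr ⟨hM21.le, by linarith, by linarith⟩)
      refine ⟨![0, 1 / μ 1 1, 0], tend3 ?_ l1 l2, ?_⟩
      · simp only [hTdef, oz]; exact tendsto_const_nhds
      · rw [hψdef]
        simp only [Fin.sum_univ_three, Matrix.cons_val, mul_zero, zero_add, add_zero, hqeq,
          one_pow, mul_one]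
        exact hA
    -- species 2 beats species 0 (1 absent)
    have caseC : x 1 = 0 → 0 < x 2 → ∃ p, Tendsto (fun n => T^[n] x) atTop (𝓝 p) ∧ 1 < ψ p := by
      intro h0 h1
      obtain ⟨o, oz⟩ := face_orb fam r μ x hx.1 2 0 1
        (fun y l => by rw [Fin.sum_univ_three]; ring) h0
      obtain ⟨l1, l2⟩ := o.dominance (hG 2) (hG 0) (hμ _ _) (hμ _ _) (hμ _ _) (hμ _ _) M2 M0
        h1 hxM2 hM21.le hxM0 hM020 (Or.inr ⟨hM01.le, by linarith, by linarith⟩)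
      refine ⟨![0, 0, 1 / μ 2 2], tend3 l2 ?_ l1, ?_⟩
      · simp only [hTdef, oz]; exact tendsto_const_nhds
      · rw [hψdef]
        simp only [Fin.sum_univ_three, Matrix.cons_val, mul_zero, zero_add, add_zero, hqeq,
          mul_one]
        rw [mul_comm]; exact hC
    rcases (hx.1 2).eq_or_lt with h2 | h2
    · have h2 : x 2 = 0 := h2.symm
      obtain ⟨o, oz⟩ := face_orb fam r μ x hx.1 0 1 2
        (fun y l => by rw [Fin.sum_univ_three]) h2
      rcases (hx.1 1).eq_or_lt with h1 | h1
      · have h1 : x 1 = 0 := h1.symm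
        rcases (hx.1 0).eq_or_lt with h0 | h0
        · have h0 : x 0 = 0 := h0.symm
          have hxz : x = 0 := by
            funext i; fin_cases i
            exacts [h0, h1, h2]
          have hfix : T x = x := by
            funext i; rw [hTe, hxz]; simp
          refine ⟨x, ?_, ?_⟩
          · simp only [Function.iterate_fixed hfix]; exact tendsto_const_nhds
          · have hg0 : ∀ i, 1 < gr fam r i 0 := fun i => (hG i).gt_one le_rfl one_pos
            rw [hψdef, hxz]
            simp only [Pi.zero_apply, mul_zero, Finset.sum_const_zero]
            exact one_lt_mul_of_lt_of_le (one_lt_mul_of_lt_of_le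
              (one_lt_pow₀ (hg0 0) (by simp)) (one_le_pow₀ (hg0 1).le)) (hg0 2).le
        · obtain ⟨l1, l2⟩ := o.dominance (hG 0) (hG 1) (hμ _ _) (hμ _ _) (hμ _ _) (hμ _ _) M0 0
            h0 hxM0 hM01.le h1.le (by simp) (Or.inl rfl)
          refine ⟨![1 / μ 0 0, 0, 0], tend3 l1 l2 ?_, ?_⟩
          · simp only [hTdef, oz]; exact tendsto_const_nhds
          · rw [hψdef]
            simp only [Fin.sum_univ_three, Matrix.cons_val, mul_zero, add_zero, hqeq,
              one_mul, one_pow]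
            exact one_lt_mul_of_lt_of_le (one_lt_pow₀ (hqlt 1 0 (by linarith)) (by simp))
              (hqlt 2 0 (by linarith)).le
      · rcases (hx.1 0).eq_or_lt with h0 | h0
        · exact caseB h0.symm h1
        · obtain ⟨l1, l2⟩ := o.coex (hG 0) (hG 1) (hμ _ _) (hμ _ _) (hμ _ _) (hμ _ _) M0 M1
            h0 hxM0 h1 hxM1 hM01.le hM010 hM1m hM11.le (by linarith) (by linarith)
          have hD : 0 < μ 0 0 * μ 1 1 - μ 0 1 * μ 1 0 := by
            nlinarith [mul_pos (hμ 0 0) hγ21, mul_pos (hμ 0 1) hγ12]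
          have hD' : 0 < μ 1 1 * μ 0 0 - μ 1 0 * μ 0 1 := by linarith
          have hb1 : 0 < DCS.beta μ 0 1 := div_pos hγ21 hD
          have hb2 : 0 < DCS.beta μ 1 0 := div_pos hγ12 hD'
          refine ⟨![DCS.beta μ 0 1, DCS.beta μ 1 0, 0], tend3 l1 l2 ?_, ?_⟩
          · simp only [hTdef, oz]; exact tendsto_const_nhds
          · have e0 : μ 0 0 * DCS.beta μ 0 1 + μ 0 1 * DCS.beta μ 1 0 = 1 := by
              unfold DCS.beta
              rw [show μ 1 1 * μ 0 0 - μ 1 0 * μ 0 1 = μ 0 0 * μ 1 1 - μ 0 1 * μ 1 0 by ring,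
                mul_div_assoc', mul_div_assoc', ← add_div, div_eq_one_iff_eq hD.ne']
              ring
            have e1 : μ 1 0 * DCS.beta μ 0 1 + μ 1 1 * DCS.beta μ 1 0 = 1 := by
              unfold DCS.beta
              rw [show μ 1 1 * μ 0 0 - μ 1 0 * μ 0 1 = μ 0 0 * μ 1 1 - μ 0 1 * μ 1 0 by ring,
                mul_div_assoc', mul_div_assoc', ← add_div, div_eq_one_iff_eq hD.ne']
              ring
            rw [hψdef]
            simp only [Fin.sum_univ_three, Matrix.cons_val, mul_zero, add_zero, e0, e1,
              (hG 0).one, (hG 1).one, one_mul, one_pow]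
            exact (hG 2).gt_one (add_nonneg (mul_nonneg (hμ _ _).le hb1.le)
              (mul_nonneg (hμ _ _).le hb2.le)) hβ
    · rcases (hx.1 1).eq_or_lt with h1 | h1
      · exact caseC h1.symm h2
      · rcases hx0 with h | h | h
        · exact caseB h h1
        · exact absurd h h1.ne'
        · exact absurd h h2.ne'
  obtain ⟨K, hK1, hK2, hK3, hK4⟩ := abs_perm (Icc (0 : Fin 3 → ℝ) M) hB
    ⟨0, le_rfl, fun i => (hMp i).1.le⟩ T hTc hTB
    (fun x => x 0 ^ (A + 1) * x 1 ^ (C + 1) * x 2) ψ (Continuous.continuousOn (by fun_prop)) hψc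
    (fun x hx => mul_nonneg (mul_nonneg (pow_nonneg (hx.1 0) _) (pow_nonneg (hx.1 1) _)) (hx.1 2))
    hψ0 (fun x hx => by
      simp only [hTe, hψdef, mul_pow]; ring) (by
      intro x hx hPx
      have hx0 : x 0 = 0 ∨ x 1 = 0 ∨ x 2 = 0 := by
        rcases mul_eq_zero.1 hPx with h | h
        · rcases mul_eq_zero.1 h with h | h
          · exact Or.inl (pow_eq_zero_iff (by simp) |>.1 h)
          · exact Or.inr (Or.inl (pow_eq_zero_iff (by simp) |>.1 h))
        · exact Or.inr (Or.inr h)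
      obtain ⟨p, hp, hp1⟩ := hbd x hx hx0
      have hmem : ∀ n, T^[n] x ∈ Icc 0 M := fun n => hTB.iterate n hx
      have hpB : p ∈ Icc 0 M :=
        isClosed_Icc.mem_of_tendsto hp (Eventually.of_forall hmem)
      exact prod_gt (fun n => hψ0 _ (hmem n)) ((hψc p hpB).tendsto.comp
        (tendsto_nhdsWithin_iff.2 ⟨hp, Eventually.of_forall hmem⟩)) hp1)
  refine ⟨K, hK1, ?_, ?_, ?_⟩
  · intro x hx i
    obtain ⟨hxB, hP⟩ := hK2 x hx
    refine lt_of_le_of_ne (hxB.1 i) fun h => ?_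
    have h : x i = 0 := h.symm
    fin_cases i <;> simp at h <;> simp [h] at hP
  · rintro _ ⟨x, hx, rfl⟩
    exact hK3 x hx
  · intro x hx
    have habs : ∀ i, ∀ᶠ n in atTop, T^[n] x i ≤ M i := by
      intro i
      obtain ⟨u, v, o, hu, hv⟩ := Orb.exists (a := μ i i) (b := μ i i) (c := μ i i) (d := μ i i)
        (hG i) (hG i) (max (x i) (M i)) 0 ((hMp i).1.le.trans (le_max_right _ _)) le_rfl
      obtain ⟨l1, -⟩ := o.dominance (hG i) (hG i) (hμ _ _) (hμ _ _) (hμ _ _) (hμ _ _)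
        (max (x i) (M i)) 0 (by rw [hu]; exact (hMp i).1.trans_le (le_max_right _ _)) hu.le
        ((hMp i).2.le.trans (mul_le_mul_of_nonneg_left (le_max_right _ _) (hμ _ _).le)) hv.le
        (by simp) (Or.inl rfl)
      have hvz : ∀ n, v n = 0 := by
        intro n
        induction n with
        | zero => exact hv
        | succ n ih => rw [o.vs, ih, zero_mul]
      have hle : ∀ n, T^[n] x i ≤ u n := by
        intro n
        induction n with
        | zero => rw [hu]; exact le_max_left _ _
        | succ n ih =>
          rw [Function.iterate_succ_apply', o.us, hvz, mul_zero, add_zero]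
          exact hcmp _ (fun j => (hitpos x hx n j).le) i _ ih
      have hlt : 1 / μ i i < M i := by
        rw [div_lt_iff₀ (hμ _ _), mul_comm]; exact (hMp i).2
      filter_upwards [l1.eventually (gt_mem_nhds hlt)] with n hn
      exact (hle n).trans hn.le
    obtain ⟨N, hN⟩ := (eventually_all.2 habs).exists
    have hNB : T^[N] x ∈ Icc 0 M := ⟨fun i => (hitpos x hx N i).le, hN⟩
    have hp := hitpos x hx N
    obtain ⟨m, hm⟩ := hK4 _ hNB
      (mul_pos (mul_pos (pow_pos (hp 0) _) (pow_pos (hp 1) _)) (hp 2))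
    rw [← Function.iterate_add_apply] at hm
    have hall : ∀ k, T^[k + (m + N)] x ∈ K := by
      intro k
      induction k with
      | zero => simpa using hm
      | succ k ih =>
        rw [Nat.succ_add, Function.iterate_succ_apply']; exact hK3 _ ih
    refine ⟨m + N + 1, by omega, fun k hk => ?_⟩
    have := hall (k - (m + N))
    rwa [Nat.sub_add_cancel (by omega)] at this
end
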